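/- Let p ≥ 10^20 be prime, let e be an even divisor of p−1, let l be a prime dividing p−1 but not dividing e, and let N, H be integers with 1 ≤ H ≤ 2·p^{5/8}. Then | N_{le}(H) − (1 − 1/l)·N_e(H) | ≤ (φ(e)/e) · W(e) · 3.5751 · H^{1/2} · p^{3/16} · (log p)^{1/4}, where W(e) = 2^{ω(e)}. -/

import Mathlib

/-- An integer `x` (indivisible by `p`) is `e`-free if for every divisor `d > 1` of `e`
the congruence `x ≡ y ^ d (mod p)` has no solution `y`. -/
def IsEFree (p e : ℕ) (x : ℤ) : Prop :=
  ¬ (p : ℤ) ∣ x ∧ ∀ d : ℕ, d ∣ e → 1 < d → ¬ ∃ y : ℤ, Int.ModEq p x (y ^ d)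

/-- `NcountEFree p e N H` is the number of integers `x` with `N + 1 ≤ x ≤ N + H` that are
indivisible by `p` and `e`-free. -/
noncomputable def NcountEFree (p e : ℕ) (N H : ℤ) : ℕ :=
  {x : ℤ | N + 1 ≤ x ∧ x ≤ N + H ∧ IsEFree p e x}.ncard

section

open Polynomial Finset

theorem card_eval_eq_pow_le {K : Type*} [Field K] [Fintype K] [DecidableEq K] {p k Q : ℕ}
    [Fact p.Prime] [CharP K p] (hQ : Q = p ^ k) (hK : Fintype.card K = Q ^ 2) {d t J J' : ℕ}
    (hd : 0 < d) (hQt : Q = d * t + 1) {f : K[X]} (hm : Nat.Coprime f.natDegree d)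
    (hf0 : f ≠ 0) (h1 : d * J + f.natDegree * d ≤ Q)
    (h2 : J * Q + J' + f.natDegree * (d * t) < d * J * J') :
    #{x : K | ∃ y, y ^ d = f.eval x} ≤ J + Q * J' + f.natDegree * Q := by
  classical
  set m := f.natDegree with hmdef
  set D := J * Q + J' + m * (d * t) with hD
  let ι := Fin d × Fin J × Fin J'
  let w : ι → K[X] := fun s ↦ X ^ (s.2.1 * Q + s.2.2 : ℕ) * f ^ (s.1 * t : ℕ)
  have hw : ∀ s, w s ∈ degreeLT K D := by
    rintro ⟨i, j, j'⟩
    rw [mem_degreeLT]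
    refine (degree_le_of_natDegree_le (n := j * Q + j' + m * (i * t)) ?_).trans_lt ?_
    · refine natDegree_mul_le_of_le (natDegree_X_pow_le _) ?_
      refine natDegree_pow_le.trans ?_
      rw [mul_comm]
    · have hi := i.2
      have hj := j.2
      have hj' := j'.2
      norm_cast
      have e1 : (j : ℕ) * Q ≤ J * Q := Nat.mul_le_mul_right _ hj.le
      have e2 : m * ((i : ℕ) * t) ≤ m * (d * t) :=
        Nat.mul_le_mul_left _ (Nat.mul_le_mul_right _ hi.le)
      omega
  have hdep : ¬ LinearIndependent K (fun s : ι ↦ (⟨w s, hw s⟩ : degreeLT K D)) := by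
    intro hli
    have : Module.Finite K (degreeLT K D) := Module.Finite.equiv (degreeLTEquiv K D).symm
    have := hli.fintype_card_le_finrank
    rw [(degreeLTEquiv K D).finrank_eq] at this
    simp only [ι, Fintype.card_prod, Fintype.card_fin, Module.finrank_fintype_fun_eq_card] at this
    rw [← mul_assoc] at this
    omega
  obtain ⟨κ, hκ, s₀, hs₀⟩ := Fintype.not_linearIndependent_iff.1 hdep
  have hκ' : ∑ s, C (κ s) * w s = 0 := by
    have := congrArg Subtype.val hκ
    simpa [smul_eq_C_mul] using this
  have hQ0 : 0 < Q := by omega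
  have hfrob : ∀ z : K, (z ^ Q) ^ Q = z := fun z ↦ by
    rw [← pow_mul, ← sq, ← hK, FiniteField.pow_card]
  let T : ι → K[X] := fun s ↦
    C (κ s ^ Q) * (X ^ (s.2.1 + Q * s.2.2 : ℕ) * f ^ (Q - s.1 * t : ℕ))
  have hTle : ∀ s : ι, (s.1 : ℕ) * t ≤ Q := fun s ↦ by
    have : (s.1 : ℕ) * t ≤ d * t := Nat.mul_le_mul_right _ s.1.2.le
    omega
  have hTdeg : ∀ s, κ s ≠ 0 → (T s).natDegree = s.2.1 + Q * s.2.2 + (Q - s.1 * t) * m := by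
    intro s hs
    have : κ s ^ Q ≠ 0 := pow_ne_zero _ hs
    simp only [T]
    rw [natDegree_C_mul this, natDegree_mul (pow_ne_zero _ X_ne_zero) (pow_ne_zero _ hf0),
      natDegree_X_pow, natDegree_pow]
  have hT0 : ∀ s, T s ≠ 0 → κ s ≠ 0 := by
    intro s hs h
    exact hs (by simp [T, h, hQ0.ne'])
  have hTne : ∀ s, κ s ≠ 0 → T s ≠ 0 := by
    intro s hs
    have : κ s ^ Q ≠ 0 := pow_ne_zero _ hs
    exact mul_ne_zero (C_ne_zero.2 this) (mul_ne_zero (pow_ne_zero _ X_ne_zero) (pow_ne_zero _ hf0))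
  let G := ∑ s, T s
  have hinj : ∀ s s' : ι, s.2.1 + Q * s.2.2 + (Q - s.1 * t) * m =
      s'.2.1 + Q * s'.2.2 + (Q - s'.1 * t) * m → s = s' := by
    rintro ⟨i, j, j'⟩ ⟨a, b, b'⟩ h
    have key : ∀ (i : Fin d) (j : Fin J) (j' : Fin J'),
        d * ((j : ℕ) + Q * j' + (Q - i * t) * m) = d * j + m * i + Q * (d * j' + m * (d - i)) := by
      intro i j j'
      have hi : (i : ℕ) ≤ d := i.2.le
      have := hTle (i, j, j')
      simp only at this
      zify [this, hi]
      have hQt' : (Q : ℤ) = d * t + 1 := by exact_mod_cast hQt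
      linear_combination ((i : ℤ) * m) * hQt'
    have hlt : ∀ (i : Fin d) (j : Fin J), d * (j : ℕ) + m * i < Q := by
      intro i j
      have e1 : d * ((j : ℕ) + 1) ≤ d * J := Nat.mul_le_mul_left _ j.2
      have e2 : m * (i : ℕ) ≤ m * d := Nat.mul_le_mul_left _ i.2.le
      rw [mul_add] at e1
      omega
    have h' := congrArg (d * ·) h
    simp only at h'
    rw [key, key] at h'
    have hu : d * (j : ℕ) + m * i = d * b + m * a := by
      have := congrArg (· % Q) h'
      simpa [Nat.add_mul_mod_self_left, Nat.mod_eq_of_lt (hlt i j),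
        Nat.mod_eq_of_lt (hlt a b)] using this
    have hv : d * (j' : ℕ) + m * (d - i) = d * b' + m * (d - a) := by
      rw [hu] at h'
      exact Nat.eq_of_mul_eq_mul_left hQ0 (Nat.add_left_cancel h')
    have hia : i = a := by
      have h3 : m * (i : ℕ) ≡ m * a [MOD d] := by
        have := congrArg (· % d) hu
        simpa [Nat.ModEq, Nat.mul_add_mod] using this
      have h4 : (i : ℕ) ≡ a [MOD d] :=
        Nat.ModEq.cancel_left_of_coprime (by rw [Nat.gcd_comm]; exact hm) h3
      exact Fin.ext (Nat.ModEq.eq_of_lt_of_lt h4 i.2 a.2)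
    subst hia
    have hjb : j = b := Fin.ext (Nat.eq_of_mul_eq_mul_left hd (Nat.add_right_cancel hu))
    have hjb' : j' = b' := Fin.ext (Nat.eq_of_mul_eq_mul_left hd (Nat.add_right_cancel hv))
    rw [hjb, hjb']
  have hG0 : G ≠ 0 := by
    have hdis : Set.Pairwise {s | s ∈ (univ : Finset ι) ∧ T s ≠ 0}
        (Function.onFun Ne (degree ∘ T)) := by
      intro s hs s' hs' hne h
      apply hne
      apply hinj
      simp only [Function.comp] at h
      rw [← hTdeg s (hT0 s hs.2), ← hTdeg s' (hT0 s' hs'.2)]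
      exact natDegree_eq_of_degree_eq h
    have := degree_sum_eq_of_disjoint T univ hdis
    intro h
    change degree G = _ at this
    rw [h, degree_zero] at this
    have h3 : degree (T s₀) ≤ univ.sup fun i ↦ degree (T i) :=
      Finset.le_sup (f := fun i ↦ degree (T i)) (mem_univ s₀)
    rw [← this, le_bot_iff, degree_eq_bot] at h3
    exact hTne s₀ hs₀ h3
  have hGdeg : G.natDegree ≤ J + Q * J' + m * Q := by
    refine natDegree_sum_le_of_forall_le _ _ fun s _ ↦ ?_
    by_cases hs : κ s = 0
    · simp [T, hs, hQ0.ne']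
    rw [hTdeg s hs]
    have e1 := s.2.1.2
    have e2 : Q * (s.2.2 : ℕ) ≤ Q * J' := Nat.mul_le_mul_left _ s.2.2.2.le
    have e3 : (Q - s.1 * t) * m ≤ Q * m := Nat.mul_le_mul_right _ (Nat.sub_le _ _)
    rw [mul_comm m Q]
    omega
  refine le_trans ?_ hGdeg
  have hsub : ({x : K | ∃ y, y ^ d = f.eval x} : Finset K) ⊆ G.roots.toFinset := by
    intro x hx
    obtain ⟨y, hy⟩ := (mem_filter.1 hx).2
    rw [Multiset.mem_toFinset, mem_roots hG0, IsRoot]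
    have hGQ : (G.eval x) ^ Q = f.eval x * (∑ s, C (κ s) * w s).eval x := by
      simp only [G, eval_finsetSum]
      have : ExpChar K p := ExpChar.prime Fact.out
      rw [hQ, sum_pow_char_pow, ← hQ, mul_sum]
      refine sum_congr rfl fun s _ ↦ ?_
      simp only [T, w, eval_mul, eval_C, eval_pow, eval_X]
      have hx2 : x ^ (Q * Q) = x := by rw [pow_mul, hfrob]
      have hy2 : y ^ (Q * Q) = y := by rw [pow_mul, hfrob]
      rw [mul_pow, hfrob, ← hy]
      have e1 : (x ^ ((s.2.1 : ℕ) + Q * s.2.2)) ^ Q = x ^ ((s.2.1 : ℕ) * Q + s.2.2) := by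
        rw [← pow_mul, add_mul, pow_add, pow_add, mul_right_comm Q, pow_mul x (Q * Q), hx2]
      have e2 : ((y ^ d) ^ (Q - s.1 * t)) ^ Q = y ^ d * (y ^ d) ^ ((s.1 : ℕ) * t) := by
        simp only [← pow_mul, ← pow_add]
        obtain ⟨c, hc⟩ : ∃ c, d = s.1 + c := ⟨d - s.1, by have := s.1.2; omega⟩
        have : d * (Q - s.1 * t) = s.1 + Q * c := by
          have : d * (Q - s.1 * t) + d * (s.1 * t) = s.1 + Q * c + d * (s.1 * t) := by
            rw [← mul_add, Nat.sub_add_cancel (hTle s)]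
            calc d * Q = (s.1 + c) * Q := by rw [← hc]
              _ = s.1 * Q + Q * c := by ring
              _ = s.1 * (d * t + 1) + Q * c := by rw [← hQt]
              _ = _ := by ring
          omega
        rw [this, add_mul, pow_add, mul_right_comm, pow_mul y (Q * Q), hy2, ← pow_add]
        congr 1
        calc s.1 * Q + c = d * (s.1 * t) + (s.1 + c) := by rw [hQt]; ring
          _ = d + d * (s.1 * t) := by rw [← hc]; ring
      rw [mul_pow, e1, e2]
      ring
    rw [hκ', eval_zero, mul_zero] at hGQ
    exact pow_eq_zero_iff hQ0.ne' |>.1 hGQ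
  calc _ ≤ #G.roots.toFinset := card_le_card hsub
    _ ≤ G.roots.card := Multiset.toFinset_card_le _
    _ ≤ _ := card_roots' _

theorem norm_mulChar_apply_le_one {F : Type*} [Field F] [Finite F] (χ : MulChar F ℂ) (a : F) :
    ‖χ a‖ ≤ 1 := by
  have := Fintype.ofFinite F
  by_cases ha : a = 0
  · simp [ha, MulChar.map_zero]
  · obtain ⟨n, hn, h⟩ : ∃ n : ℕ, n ≠ 0 ∧ χ a ^ n = 1 := by
      refine ⟨Fintype.card F - 1, ?_, ?_⟩
      · have := Fintype.one_lt_card (α := F); omega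
      · rw [← map_pow, FiniteField.pow_card_sub_one_eq_one a ha, map_one]
    exact (Complex.norm_eq_one_of_pow_eq_one h hn).le

theorem norm_sum_mulChar_eval_le {K : Type*} [Field K] [Fintype K] [DecidableEq K] {d T : ℕ}
    (hd : 0 < d) {θ : MulChar K ℂ} (hθ1 : θ ≠ 1) (hθd : θ ^ d = 1) {f : K[X]} (hf0 : f ≠ 0)
    (hT : ∀ c : K, c ≠ 0 → #{x : K | ∃ y, y ^ d = c * f.eval x} ≤ T) :
    ‖∑ x, θ (f.eval x)‖ ≤ d * T - Fintype.card K + f.natDegree := by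
  classical
  let P : K → K → Prop := fun c x ↦ c ≠ 0 ∧ f.eval x ≠ 0 ∧ ∃ y, y ^ d = c * f.eval x
  let D : Finset K := {z | z ≠ 0 ∧ ∃ y, y ^ d = z}
  have hθpow : ∀ y : K, y ≠ 0 → θ (y ^ d) = 1 := fun y hy ↦ by
    rw [map_pow, ← MulChar.pow_apply' θ hd.ne', hθd, MulChar.one_apply hy.isUnit]
  have hfib : ∀ x, (∑ c, if P c x then θ⁻¹ c else 0) = #D * θ (f.eval x) := by
    intro x
    by_cases hv : f.eval x = 0
    · simp [P, hv, MulChar.map_zero]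
    rw [← sum_filter]
    calc ∑ c with P c x, θ⁻¹ c = ∑ z ∈ D, θ (f.eval x) := by
          refine sum_bij' (fun c _ ↦ c * f.eval x) (fun z _ ↦ z / f.eval x) ?_ ?_ ?_ ?_ ?_
          · intro c hc
            obtain ⟨h1, h2, h3⟩ := (mem_filter.1 hc).2
            exact mem_filter.2 ⟨mem_univ _, mul_ne_zero h1 h2, h3⟩
          · intro z hz
            obtain ⟨h1, y, h2⟩ := (mem_filter.1 hz).2
            refine mem_filter.2 ⟨mem_univ _, div_ne_zero h1 hv, hv, y, ?_⟩
            rw [h2]; field_simp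
          · intro c _; field_simp
          · intro z _; field_simp
          · intro c hc
            obtain ⟨h1, h2, y, h3⟩ := (mem_filter.1 hc).2
            have hy : y ≠ 0 := by
              rintro rfl
              rw [zero_pow hd.ne'] at h3
              exact mul_ne_zero h1 h2 h3.symm
            have h4 := hθpow y hy
            rw [h3, map_mul] at h4
            rw [MulChar.inv_apply_eq_inv']
            exact inv_eq_of_mul_eq_one_right h4
      _ = _ := by simp
  have hS : (#D : ℂ) * ∑ x, θ (f.eval x) = ∑ c, θ⁻¹ c * (#{x | P c x} - T) := by
    have h0 : ∑ c, θ⁻¹ c = 0 := MulChar.sum_eq_zero_of_ne_one (by simpa using hθ1)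
    simp_rw [mul_sub]
    rw [sum_sub_distrib, ← sum_mul, h0, zero_mul, sub_zero, mul_sum]
    simp_rw [← hfib]
    rw [sum_comm]
    refine sum_congr rfl fun c _ ↦ ?_
    rw [← sum_filter, sum_const, nsmul_eq_mul, mul_comm]
  have hMT : ∀ c : K, c ≠ 0 → (#{x | P c x} : ℝ) ≤ T := by
    intro c hc
    have : #{x | P c x} ≤ T :=
      (card_le_card fun x hx ↦ by
        simp only [mem_filter, P, mem_univ, true_and] at hx ⊢
        exact hx.2.2).trans (hT c hc)
    exact_mod_cast this
  have hMsum : ∑ c, #{x | P c x} = #D * #{x | f.eval x ≠ 0} := by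
    simp_rw [card_filter]
    rw [sum_comm, mul_sum]
    refine sum_congr rfl fun x _ ↦ ?_
    by_cases hv : f.eval x = 0
    · simp [P, hv]
    rw [if_pos hv, mul_one, ← card_filter]
    refine card_bij' (fun c _ ↦ c * f.eval x) (fun z _ ↦ z / f.eval x) ?_ ?_ ?_ ?_
    · intro c hc
      obtain ⟨h1, h2, h3⟩ := (mem_filter.1 hc).2
      exact mem_filter.2 ⟨mem_univ _, mul_ne_zero h1 h2, h3⟩
    · intro z hz
      obtain ⟨h1, y, h2⟩ := (mem_filter.1 hz).2
      refine mem_filter.2 ⟨mem_univ _, div_ne_zero h1 hv, hv, y, ?_⟩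
      rw [h2]; field_simp
    · intro c _; field_simp
    · intro z _; field_simp
  have hDcard : Fintype.card K - 1 ≤ d * #D := by
    have h1 : #(univ.erase (0 : K)) = Fintype.card K - 1 := by
      rw [card_erase_of_mem (mem_univ _), card_univ]
    rw [← h1]
    have h2 : (univ.erase (0 : K)).image (· ^ d) = D := by
      ext z
      simp only [mem_image, mem_erase, mem_univ, and_true, D, mem_filter, true_and]
      constructor
      · rintro ⟨y, hy, rfl⟩; exact ⟨pow_ne_zero _ hy, y, rfl⟩
      · rintro ⟨hz, y, rfl⟩
        exact ⟨y, fun h ↦ hz (by simp [h, hd.ne']), rfl⟩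
    rw [← h2]
    refine card_le_mul_card_image _ _ fun z _ ↦ ?_
    calc _ ≤ #(nthRoots d z).toFinset := card_le_card fun y hy ↦ by
          rw [Multiset.mem_toFinset, mem_nthRoots hd]
          exact (mem_filter.1 hy).2
      _ ≤ _ := (Multiset.toFinset_card_le _).trans (card_nthRoots _ _)
  have hZ : Fintype.card K ≤ #{x | f.eval x ≠ 0} + f.natDegree := by
    have h1 := card_filter_add_card_filter_not (s := (univ : Finset K)) (fun x ↦ f.eval x ≠ 0)
    rw [card_univ] at h1
    have h2 : #{x | ¬ f.eval x ≠ 0} ≤ f.natDegree := by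
      refine (card_le_card (t := f.roots.toFinset) fun x hx ↦ ?_).trans
        ((Multiset.toFinset_card_le _).trans (card_roots' f))
      rw [Multiset.mem_toFinset, mem_roots hf0]
      simpa using hx
    omega
  have hnorm : (#D : ℝ) * ‖∑ x, θ (f.eval x)‖ ≤
      (Fintype.card K - 1 : ℝ) * T - #D * #{x | f.eval x ≠ 0} := by
    have h1 : (#D : ℝ) * ‖∑ x, θ (f.eval x)‖ = ‖∑ c, θ⁻¹ c * (#{x | P c x} - T)‖ := by
      rw [← hS, norm_mul, Complex.norm_natCast]
    rw [h1]
    calc _ ≤ ∑ c, ‖θ⁻¹ c * (#{x | P c x} - T)‖ := norm_sum_le _ _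
      _ ≤ ∑ c ∈ univ.erase (0 : K), ((T : ℝ) - #{x | P c x}) := by
        rw [← sum_erase (univ : Finset K) (a := (0 : K)) (by simp [MulChar.map_zero])]
        refine sum_le_sum fun c hc ↦ ?_
        have h2 := hMT c (ne_of_mem_erase hc)
        have h3 : ‖((#{x | P c x} : ℂ) - T)‖ = T - #{x | P c x} := by
          rw [← Complex.ofReal_natCast, ← Complex.ofReal_natCast, ← Complex.ofReal_sub,
            Complex.norm_real, Real.norm_eq_abs, abs_of_nonpos (by linarith)]
          ring
        rw [norm_mul, h3]
        exact mul_le_of_le_one_left (by linarith) (norm_mulChar_apply_le_one _ _)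
      _ = _ := by
        rw [sum_sub_distrib, sum_const, card_erase_of_mem (mem_univ _), card_univ, nsmul_eq_mul,
          Nat.cast_sub Fintype.card_pos]
        congr 1
        · simp
        rw [sum_erase _ (by simp [P])]
        exact_mod_cast hMsum
  have hDpos : (0 : ℝ) < #D := by
    have := Fintype.one_lt_card (α := K)
    have : 0 < d * #D := by omega
    exact_mod_cast Nat.pos_of_mul_pos_left this
  refine le_of_mul_le_mul_left (hnorm.trans ?_) hDpos
  have h1 : (Fintype.card K - 1 : ℝ) ≤ d * #D := by
    have := Fintype.card_pos (α := K)
    rw [← Nat.cast_one, ← Nat.cast_sub this]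
    exact_mod_cast hDcard
  have h2 : (Fintype.card K : ℝ) ≤ #{x | f.eval x ≠ 0} + f.natDegree := by exact_mod_cast hZ
  nlinarith [mul_le_mul_of_nonneg_right h1 (Nat.cast_nonneg (α := ℝ) T),
    mul_le_mul_of_nonneg_left h2 hDpos.le]

theorem norm_sum_mulChar_eval_le_mul_sqrt {K : Type*} [Field K] [Fintype K] {p k Q : ℕ}
    [Fact p.Prime] [CharP K p] (hQ : Q = p ^ k) (hK : Fintype.card K = Q ^ 2) {d : ℕ}
    (hd : 2 ≤ d) (hdQ : d ∣ Q - 1) {θ : MulChar K ℂ} (hθ1 : θ ≠ 1) (hθd : θ ^ d = 1) {f : K[X]}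
    (hf0 : f ≠ 0) (hm : Nat.Coprime f.natDegree d) (hlarge : d * (2 * f.natDegree + 4) + 1 ≤ Q) :
    ‖∑ x, θ (f.eval x)‖ ≤ (d * (3 * f.natDegree + 4) + f.natDegree) * Q := by
  classical
  set m := f.natDegree with hmdef
  obtain ⟨t, ht⟩ := hdQ
  have hQt : Q = d * t + 1 := by omega
  have htm : 2 * m + 4 ≤ t := by
    have : d * (2 * m + 4) ≤ d * t := by omega
    exact Nat.le_of_mul_le_mul_left this (by omega)
  obtain ⟨J, hJ⟩ : ∃ J, t = J + m := ⟨t - m, by omega⟩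
  have hdpos : 0 < d := by omega
  have hT : ∀ c : K, c ≠ 0 → #{x : K | ∃ y, y ^ d = c * f.eval x} ≤
      J + Q * (t + (2 * m + 4)) + m * Q := by
    intro c hc
    have hdeg : (C c * f).natDegree = m := natDegree_C_mul hc
    have := card_eval_eq_pow_le (J := J) (J' := t + (2 * m + 4)) (f := C c * f) hQ hK hdpos hQt
      (by rwa [hdeg]) (mul_ne_zero (C_ne_zero.2 hc) hf0)
      (by rw [hdeg, hQt, hJ]; ring_nf; omega) (by
        rw [hdeg]
        zify at hQt hJ htm hd ⊢
        have h1 : (d : ℤ) * J * (t + (2 * m + 4)) =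
          J * Q + J * (d * (2 * m + 4) - 1) := by rw [hQt]; ring
        rw [h1]
        have h2 : (t : ℤ) ≤ 2 * J := by linarith
        have h3 : (0 : ℤ) ≤ d * (2 * m + 4) - 1 := by nlinarith
        nlinarith [mul_le_mul_of_nonneg_right h2 h3])
    rw [hdeg] at this
    simpa using this
  have := norm_sum_mulChar_eval_le hdpos hθ1 hθd hf0 hT
  refine this.trans ?_
  rw [hK, ← hmdef]
  push_cast
  have hQr : (Q : ℝ) = d * t + 1 := by exact_mod_cast hQt
  have hJr : (t : ℝ) = J + m := by exact_mod_cast hJ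
  have e : (d : ℝ) * (J + Q * (t + (2 * m + 4)) + m * Q) - Q ^ 2 + m =
      d * (3 * m + 4) * Q + m - d * m + (d * t - Q) := by
    have : (d : ℝ) * J = d * t - d * m := by rw [hJr]; ring
    have h2 : (d : ℝ) * t * Q = Q * Q - Q := by
      have : (d : ℝ) * t = Q - 1 := by linarith
      rw [this]; ring
    linear_combination this + h2
  rw [e]
  have : (1 : ℝ) ≤ Q := by exact_mod_cast (show 1 ≤ Q by omega)
  nlinarith [mul_nonneg (Nat.cast_nonneg (α := ℝ) d) (Nat.cast_nonneg (α := ℝ) m),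
    mul_le_mul_of_nonneg_left this (Nat.cast_nonneg (α := ℝ) m)]

namespace Polynomial

section monicOfNatDegree

variable {F : Type*} [Field F] [Finite F]

theorem finite_setOf_natDegree_le (n : ℕ) : {g : F[X] | g.natDegree ≤ n}.Finite := by
  have : Finite (degreeLT F (n + 1)) := Finite.of_equiv _ (degreeLTEquiv F (n + 1)).toEquiv.symm
  refine (Set.toFinite (degreeLT F (n + 1) : Set F[X])).subset fun g hg ↦ ?_
  rw [SetLike.mem_coe, mem_degreeLT]
  exact (degree_le_of_natDegree_le hg).trans_lt (by exact_mod_cast Nat.lt_succ_self n)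

variable (F) in
/-- The finite set of monic polynomials of degree `n` over a finite field. -/
noncomputable def monicOfNatDegree (n : ℕ) : Finset F[X] :=
  ((finite_setOf_natDegree_le n).subset
    (fun _ h ↦ h.2.le : {g : F[X] | g.Monic ∧ g.natDegree = n} ⊆ _)).toFinset

@[simp]
theorem mem_monicOfNatDegree {n : ℕ} {g : F[X]} :
    g ∈ monicOfNatDegree F n ↔ g.Monic ∧ g.natDegree = n := by
  simp [monicOfNatDegree]

open scoped Classical in
theorem natDegree_eq_sum_irreducible_pow_dvd {g : F[X]} (hg : g.Monic) {n : ℕ}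
    (hn : g.natDegree = n) :
    n = ∑ D ∈ Icc 1 n, ∑ P ∈ monicOfNatDegree F D with Irreducible P,
      ∑ j ∈ Icc 1 n, if P ^ j ∣ g then D else 0 := by
  let s := UniqueFactorizationMonoid.normalizedFactors g
  have hg0 : g ≠ 0 := hg.ne_zero
  have hs : ∀ P, P ∈ s ↔ Irreducible P ∧ P.Monic ∧ P ∣ g := fun P ↦
    Polynomial.mem_normalizedFactors_iff hg0
  have hprod : s.prod = g := by
    have := leadingCoeff_mul_prod_normalizedFactors g
    rwa [hg.leadingCoeff, C_1, one_mul] at this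
  have hdeg : n = ∑ P ∈ s.toFinset, s.count P * P.natDegree := by
    rw [← hn]
    conv_lhs => rw [← hprod]
    rw [natDegree_multiset_prod_of_monic _ fun f hf ↦ ((hs f).1 hf).2.1,
      Finset.sum_multiset_map_count]
    simp
  have hcount : ∀ P ∈ s, P.natDegree ∈ Icc 1 n ∧
      ∑ j ∈ Icc 1 n, (if P ^ j ∣ g then P.natDegree else 0) = s.count P * P.natDegree := by
    intro P hP
    obtain ⟨hirr, hmon, hdvd⟩ := (hs P).1 hP
    have hpos : 1 ≤ P.natDegree := hirr.natDegree_pos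
    have hiff : ∀ j : ℕ, P ^ j ∣ g ↔ j ≤ s.count P := by
      intro j
      rw [pow_dvd_iff_le_emultiplicity,
        UniqueFactorizationMonoid.emultiplicity_eq_count_normalizedFactors hirr hg0,
        hmon.normalize_eq_self]
      exact_mod_cast Iff.rfl
    refine ⟨mem_Icc.2 ⟨hpos, hn ▸ natDegree_le_of_dvd hdvd hg0⟩, ?_⟩
    have hle : s.count P ≤ n := by
      have h1 := natDegree_le_of_dvd ((hiff _).2 le_rfl) hg0
      rw [natDegree_pow, hn] at h1
      exact (Nat.le_mul_of_pos_right _ hpos).trans h1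
    rw [← sum_filter, sum_const, smul_eq_mul]
    congr 1
    have : {j ∈ Icc 1 n | P ^ j ∣ g} = Icc 1 (s.count P) := by
      ext j
      simp only [mem_filter, mem_Icc, hiff]
      omega
    rw [this, Nat.card_Icc, Nat.add_sub_cancel]
  have hmaps : ∀ P ∈ s.toFinset, P.natDegree ∈ Icc 1 n := fun P hP ↦
    (hcount P (Multiset.mem_toFinset.1 hP)).1
  conv_lhs => rw [hdeg]
  rw [← sum_fiberwise_of_maps_to hmaps]
  refine sum_congr rfl fun D hD ↦ ?_
  symm
  refine (sum_subset (fun P hP ↦ ?_) fun P hP hPn ↦ ?_).symm.trans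
    (sum_congr rfl fun P hP ↦ ?_)
  · obtain ⟨h1, rfl⟩ := mem_filter.1 hP
    obtain ⟨hirr, hmon, -⟩ := (hs P).1 (Multiset.mem_toFinset.1 h1)
    exact mem_filter.2 ⟨mem_monicOfNatDegree.2 ⟨hmon, rfl⟩, hirr⟩
  · obtain ⟨h1, hirr⟩ := mem_filter.1 hP
    obtain ⟨hmon, hPD⟩ := mem_monicOfNatDegree.1 h1
    refine sum_eq_zero fun j hj ↦ if_neg fun hdvd ↦ hPn ?_
    rw [mem_filter, Multiset.mem_toFinset, hs]
    exact ⟨⟨hirr, hmon, (dvd_pow_self P (by have := mem_Icc.1 hj; omega)).trans hdvd⟩, hPD⟩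
  · obtain ⟨h1, rfl⟩ := mem_filter.1 hP
    exact (hcount P (Multiset.mem_toFinset.1 h1)).2

variable (W : F[X] →* ℂ)

open scoped Classical in
theorem sum_monicOfNatDegree_pow_dvd {P : F[X]} (hP : P.Monic) {j n : ℕ} :
    (∑ g ∈ monicOfNatDegree F n, if P ^ j ∣ g then W g else 0) =
      if j * P.natDegree ≤ n then
        W P ^ j * ∑ h ∈ monicOfNatDegree F (n - j * P.natDegree), W h else 0 := by
  have hPj : (P ^ j).Monic := hP.pow j
  rw [← sum_filter]
  split_ifs with hjn
  · rw [mul_sum]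
    symm
    refine sum_bij (fun h _ ↦ P ^ j * h) ?_ ?_ ?_ ?_
    · intro h hh
      obtain ⟨h1, h2⟩ := mem_monicOfNatDegree.1 hh
      refine mem_filter.2 ⟨mem_monicOfNatDegree.2 ⟨hPj.mul h1, ?_⟩, dvd_mul_right _ _⟩
      rw [hPj.natDegree_mul h1, natDegree_pow, h2]
      omega
    · intro h _ h' _ e
      exact mul_left_cancel₀ hPj.ne_zero e
    · intro g hg
      obtain ⟨hg1, h, rfl⟩ := mem_filter.1 hg
      obtain ⟨h1, h2⟩ := mem_monicOfNatDegree.1 hg1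
      have hh : h.Monic := hPj.of_mul_monic_left h1
      refine ⟨h, mem_monicOfNatDegree.2 ⟨hh, ?_⟩, rfl⟩
      rw [hPj.natDegree_mul hh, natDegree_pow] at h2
      omega
    · intro h _
      rw [map_mul, map_pow]
  · refine sum_eq_zero fun g hg ↦ ?_
    exfalso
    obtain ⟨hg1, hdvd⟩ := mem_filter.1 hg
    obtain ⟨h1, h2⟩ := mem_monicOfNatDegree.1 hg1
    have := natDegree_le_of_dvd hdvd h1.ne_zero
    rw [natDegree_pow] at this
    omega

open scoped Classical in
/-- The sum over prime powers of degree `k` of a completely multiplicative function, weighted by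
the degree of the prime. -/
noncomputable def primePowerSum (k : ℕ) : ℂ :=
  ∑ D ∈ k.divisors, ∑ P ∈ monicOfNatDegree F D with Irreducible P, D * W P ^ (k / D)

theorem natCast_mul_sum_monicOfNatDegree (n : ℕ) :
    n * ∑ g ∈ monicOfNatDegree F n, W g =
      ∑ k ∈ Icc 1 n, primePowerSum W k * ∑ g ∈ monicOfNatDegree F (n - k), W g := by
  classical
  set a : ℕ → ℂ := fun n ↦ ∑ g ∈ monicOfNatDegree F n, W g with ha
  have h1 : n * a n = ∑ D ∈ Icc 1 n, ∑ P ∈ monicOfNatDegree F D with Irreducible P,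
      ∑ j ∈ Icc 1 n, if j * D ≤ n then D * W P ^ j * a (n - j * D) else 0 := by
    calc n * a n = ∑ g ∈ monicOfNatDegree F n, n * W g := mul_sum _ _ _
      _ = ∑ g ∈ monicOfNatDegree F n, ∑ D ∈ Icc 1 n,
          ∑ P ∈ monicOfNatDegree F D with Irreducible P,
            ∑ j ∈ Icc 1 n, D * if P ^ j ∣ g then W g else 0 := by
        refine sum_congr rfl fun g hg ↦ ?_
        obtain ⟨hg1, hg2⟩ := mem_monicOfNatDegree.1 hg
        have := congrArg (fun m : ℕ ↦ (m : ℂ) * W g) (natDegree_eq_sum_irreducible_pow_dvd hg1 hg2)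
        simp only [Nat.cast_sum, sum_mul] at this
        rw [this]
        refine sum_congr rfl fun D _ ↦ sum_congr rfl fun P _ ↦ sum_congr rfl fun j _ ↦ ?_
        split_ifs <;> simp
      _ = _ := by
        rw [sum_comm]
        refine sum_congr rfl fun D _ ↦ ?_
        rw [sum_comm]
        refine sum_congr rfl fun P hP ↦ ?_
        obtain ⟨hmon, rfl⟩ := mem_monicOfNatDegree.1 (mem_filter.1 hP).1
        rw [sum_comm]
        refine sum_congr rfl fun j _ ↦ ?_
        rw [← mul_sum, sum_monicOfNatDegree_pow_dvd W hmon]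
        split_ifs
        · rw [mul_assoc]
        · simp
  rw [h1]
  have h2 : ∀ k ∈ Icc 1 n, primePowerSum W k * a (n - k) = ∑ D ∈ Icc 1 n,
      ∑ P ∈ monicOfNatDegree F D with Irreducible P,
        if D ∣ k then D * W P ^ (k / D) * a (n - k) else 0 := by
    intro k hk
    rw [mem_Icc] at hk
    have : k.divisors = {D ∈ Icc 1 n | D ∣ k} := by
      ext D
      simp only [Nat.mem_divisors, mem_filter, mem_Icc]
      constructor
      · rintro ⟨h, h0⟩
        exact ⟨⟨Nat.pos_of_dvd_of_pos h hk.1, (Nat.le_of_dvd hk.1 h).trans hk.2⟩, h⟩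
      · rintro ⟨-, h⟩
        exact ⟨h, by omega⟩
    rw [primePowerSum, this, sum_filter, sum_mul]
    refine sum_congr rfl fun D _ ↦ ?_
    split_ifs
    · rw [sum_mul]
    · simp
  rw [sum_congr rfl h2, sum_comm]
  refine sum_congr rfl fun D hD ↦ ?_
  conv_rhs => rw [sum_comm]
  refine sum_congr rfl fun P hP ↦ ?_
  have hDpos : 0 < D := (mem_Icc.1 hD).1
  rw [← sum_filter, ← sum_filter]
  refine sum_nbij' (fun j ↦ j * D) (fun k ↦ k / D) ?_ ?_ ?_ ?_ ?_
  · intro j hj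
    simp only [mem_filter, mem_Icc] at hj ⊢
    exact ⟨⟨Nat.mul_pos hj.1.1 hDpos, hj.2⟩, dvd_mul_left _ _⟩
  · intro k hk
    simp only [mem_filter, mem_Icc] at hk ⊢
    obtain ⟨⟨hk1, hk2⟩, i, rfl⟩ := hk
    rw [Nat.mul_div_cancel_left _ hDpos, mul_comm i D]
    have : 0 < i := Nat.pos_of_mul_pos_left (show 0 < D * i by omega)
    exact ⟨⟨this, (Nat.le_mul_of_pos_left i hDpos).trans hk2⟩, hk2⟩
  · intro j _
    exact Nat.mul_div_cancel _ hDpos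
  · intro k hk
    exact Nat.div_mul_cancel (mem_filter.1 hk).2
  · intro j _
    rw [Nat.mul_div_cancel _ hDpos]

end monicOfNatDegree

variable {F K : Type*} [Field F] [Field K] [Algebra F K]

theorem card_setOf_minpoly_eq [Fintype K] [DecidableEq F[X]] {P : F[X]} (hmon : P.Monic)
    (hirr : Irreducible P) (hdvd : P.natDegree ∣ Module.finrank F K) :
    #{x : K | minpoly F x = P} = P.natDegree := by
  classical
  have : Fact (Irreducible P) := ⟨hirr⟩
  have hfin : Module.finrank F (AdjoinRoot P) = P.natDegree := by
    rw [(AdjoinRoot.powerBasis hirr.ne_zero).finrank, AdjoinRoot.powerBasis_dim]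
  have h1 := FiniteField.natCard_algHom_of_finrank_dvd (F := F) (K := AdjoinRoot P) (L := K)
    (by rwa [hfin])
  rw [hfin, Nat.card_congr (AdjoinRoot.equiv K F P hirr.ne_zero)] at h1
  rw [← h1, ← Fintype.card_coe, Fintype.card_eq_nat_card]
  refine Nat.card_congr (Equiv.subtypeEquivRight fun x ↦ ?_)
  rw [mem_filter, mem_aroots]
  constructor
  · rintro ⟨-, rfl⟩
    exact ⟨hirr.ne_zero, minpoly.aeval _ _⟩
  · rintro ⟨-, h⟩
    exact ⟨mem_univ _, (minpoly.eq_of_irreducible_of_monic hirr h hmon).symm⟩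

theorem sum_minpoly_pow_eq_primePowerSum [Finite F] [Fintype K] (W : F[X] →* ℂ) :
    ∑ x : K, W (minpoly F x) ^ (Module.finrank F K / (minpoly F x).natDegree) =
      primePowerSum W (Module.finrank F K) := by
  classical
  set n := Module.finrank F K
  have hn : 0 < n := Module.finrank_pos
  have hdvd : ∀ x : K, (minpoly F x).natDegree ∣ n := fun x ↦
    minpoly.degree_dvd (IsIntegral.of_finite F x)
  rw [primePowerSum, ← sum_fiberwise_of_maps_to (s := univ) (t := n.divisors)
    (g := fun x : K ↦ (minpoly F x).natDegree)
    fun x _ ↦ Nat.mem_divisors.2 ⟨hdvd x, hn.ne'⟩]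
  refine sum_congr rfl fun D hD ↦ ?_
  rw [← sum_fiberwise_of_maps_to (t := {P ∈ monicOfNatDegree F D | Irreducible P})
    (g := fun x : K ↦ minpoly F x) fun x hx ↦ ?_]
  · refine sum_congr rfl fun P hP ↦ ?_
    obtain ⟨h1, hirr⟩ := mem_filter.1 hP
    obtain ⟨hmon, rfl⟩ := mem_monicOfNatDegree.1 h1
    have : ({x ∈ {x : K | (minpoly F x).natDegree = P.natDegree} | minpoly F x = P} : Finset K) =
        ({x : K | minpoly F x = P} : Finset K) := by
      ext x
      simp only [mem_filter, mem_univ, true_and, and_iff_right_iff_imp]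
      exact congrArg _
    rw [this, sum_congr rfl (g := fun _ ↦ W P ^ (n / P.natDegree))
      (fun x hx ↦ by rw [(mem_filter.1 hx).2]), sum_const, nsmul_eq_mul,
      card_setOf_minpoly_eq hmon hirr (Nat.dvd_of_mem_divisors hD)]
  · have hx' := IsIntegral.of_finite F x
    exact mem_filter.2 ⟨mem_monicOfNatDegree.2 ⟨minpoly.monic hx', (mem_filter.1 hx).2⟩,
      minpoly.irreducible hx'⟩

theorem norm_algebraMap_sub [Finite F] [Finite K] (a : F) (x : K) :
    Algebra.norm F (algebraMap F K a - x) =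
      (minpoly F x).eval a ^ (Module.finrank F K / (minpoly F x).natDegree) := by
  have hx := IsIntegral.of_finite F x
  set y := x - algebraMap F K a with hy
  have hyi := IsIntegral.of_finite F y
  have hmin : minpoly F y = (minpoly F x).comp (X + C a) := minpoly.sub_algebraMap x a
  have hdeg : (minpoly F y).natDegree = (minpoly F x).natDegree := by
    rw [hmin, natDegree_comp, natDegree_X_add_C, mul_one]
  have hfin : (minpoly F y).natDegree * Module.finrank (IntermediateField.adjoin F {y}) K =
      Module.finrank F K := by
    rw [← IntermediateField.adjoin.finrank hyi, Module.finrank_mul_finrank]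
  have hpos : 0 < (minpoly F y).natDegree := minpoly.natDegree_pos hyi
  have hgen := Algebra.PowerBasis.norm_gen_eq_coeff_zero_minpoly
    (IntermediateField.adjoin.powerBasis hyi)
  rw [IntermediateField.adjoin.powerBasis_gen, IntermediateField.adjoin.powerBasis_dim,
    IntermediateField.minpoly_gen, coeff_zero_eq_eval_zero] at hgen
  have hN : Algebra.norm F y = ((-1) ^ (minpoly F y).natDegree * (minpoly F y).eval 0) ^
      Module.finrank (IntermediateField.adjoin F {y}) K := by
    rw [Algebra.norm_eq_norm_adjoin, hgen]
  have hneg : algebraMap F K a - x = algebraMap F K (-1) * y := by simp [hy]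
  rw [hneg, map_mul, Algebra.norm_algebraMap, hN, mul_pow, ← pow_mul, hfin, ← mul_assoc,
    ← mul_pow, neg_one_mul, neg_neg, one_pow, one_mul, ← hdeg]
  congr 1
  · rw [hmin, eval_comp]; simp
  · exact (Nat.div_eq_of_eq_mul_right hpos hfin.symm).symm

end Polynomial

theorem norm_le_of_norm_pow_add_pow_le {w z : ℂ} {R C : ℝ} {k₀ : ℕ} (hR : 0 < R)
    (h : ∀ k ≥ k₀, ‖w ^ k + z ^ k‖ ≤ C * R ^ k) : ‖w‖ ≤ R := by
  by_contra! hlt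
  set ρ := ‖w‖ / R with hρ
  have hρ1 : 1 < ρ := (one_lt_div hR).2 hlt
  have hC : 0 ≤ C := by
    have := (norm_nonneg _).trans (h k₀ le_rfl)
    exact nonneg_of_mul_nonneg_left this (by positivity)
  obtain ⟨n, hn⟩ := pow_unbounded_of_one_lt (C + (C ^ 2 + C) / 2 + 1) hρ1
  set k := max n k₀
  have hk : C + (C ^ 2 + C) / 2 + 1 < ρ ^ k :=
    hn.trans_le (pow_le_pow_right₀ hρ1.le (le_max_left _ _))
  have hid : w ^ (2 * k) = w ^ k * (w ^ k + z ^ k) -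
      ((w ^ k + z ^ k) ^ 2 - (w ^ (2 * k) + z ^ (2 * k))) / 2 := by
    rw [mul_comm 2 k, pow_mul, pow_mul]; ring
  have h1 := h k (le_max_right _ _)
  have h2 := h (2 * k) ((le_max_right _ _).trans (by omega : k ≤ 2 * k))
  have hw : ‖w‖ = ρ * R := by rw [hρ]; field_simp
  have hmain : ρ ^ (2 * k) * R ^ (2 * k) ≤
      ρ ^ k * R ^ k * (C * R ^ k) + ((C * R ^ k) ^ 2 + C * R ^ (2 * k)) / 2 := by
    calc ρ ^ (2 * k) * R ^ (2 * k) = ‖w ^ (2 * k)‖ := by rw [norm_pow, hw, mul_pow]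
    _ ≤ ‖w ^ k‖ * ‖w ^ k + z ^ k‖ + (‖w ^ k + z ^ k‖ ^ 2 + ‖w ^ (2 * k) + z ^ (2 * k)‖) / 2 := by
      refine (congrArg norm hid).le.trans ((norm_sub_le _ _).trans ?_)
      rw [norm_mul, norm_div, RCLike.norm_ofNat]
      refine add_le_add le_rfl (div_le_div_of_nonneg_right ?_ (by norm_num))
      exact (norm_sub_le _ _).trans_eq (by rw [norm_pow])
    _ ≤ _ := by
      rw [norm_pow, hw, mul_pow]
      have : 0 ≤ ρ := by positivity
      gcongr
  have hR' : 0 < R ^ (2 * k) := by positivity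
  have hmain' : (ρ ^ k) ^ 2 ≤ ρ ^ k * C + (C ^ 2 + C) / 2 := by
    refine le_of_mul_le_mul_right ?_ hR'
    calc _ = ρ ^ (2 * k) * R ^ (2 * k) := by ring
    _ ≤ _ := hmain
    _ = _ := by ring
  nlinarith [one_le_pow₀ hρ1.le (n := k)]

theorem norm_le_two_mul_sqrt_of_newton {S a : ℕ → ℂ} (h0 : a 0 = 1) (ha : ∀ n ≥ 3, a n = 0)
    (hS : ∀ n : ℕ, n * a n = ∑ k ∈ Icc 1 n, S k * a (n - k)) {q C : ℝ} {k₀ : ℕ} (hq : 0 < q)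
    (h : ∀ k ≥ k₀, ‖S (2 * k)‖ ≤ C * q ^ k) : ‖a 1‖ ≤ 2 * √q := by
  obtain ⟨s, hs⟩ := IsAlgClosed.exists_pow_nat_eq (a 1 ^ 2 - 4 * a 2) (n := 2) (by norm_num)
  set u := (-a 1 + s) / 2 with hu
  set v := (-a 1 - s) / 2 with hv
  have hadd : u + v = -a 1 := by rw [hu, hv]; ring
  have hmul : u * v = a 2 := by rw [hu, hv]; linear_combination (-1 / 4) * hs
  have h1 : S 1 = -(u ^ 1 + v ^ 1) := by
    have := hS 1
    simp [h0] at this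
    rw [pow_one, pow_one, hadd, this, neg_neg]
  have h2 : S 2 = -(u ^ 2 + v ^ 2) := by
    have := hS 2
    rw [show Icc 1 2 = {1, 2} from rfl, sum_pair (by norm_num)] at this
    norm_num [h0, h1] at this
    linear_combination -this + (u + v) * hadd - 2 * hmul
  have hall : ∀ n, S (n + 1) = -(u ^ (n + 1) + v ^ (n + 1)) ∧
      S (n + 2) = -(u ^ (n + 2) + v ^ (n + 2)) := by
    intro n
    induction n with
    | zero => exact ⟨h1, h2⟩
    | succ n ih =>
      refine ⟨ih.2, ?_⟩
      have := hS (n + 3)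
      rw [ha (n + 3) (by omega), sum_Icc_succ_top (by omega), sum_Icc_succ_top (by omega),
        sum_Icc_succ_top (by omega), sum_eq_zero, show n + 3 - (n + 2 + 1) = 0 by omega,
        show n + 3 - (n + 1 + 1) = 1 by omega, show n + 3 - (n + 1) = 2 by omega, ih.1, ih.2, h0]
        at this
      · rw [show n + 1 + 2 = n + 2 + 1 by omega]
        have e1 : a 1 = -(u + v) := by rw [hadd, neg_neg]
        rw [e1, ← hmul] at this
        linear_combination -this
      · intro k hk
        rw [mem_Icc] at hk
        rw [ha (n + 3 - k) (by omega), mul_zero]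
  have hu2 : ∀ k ≥ max k₀ 1, ‖(u ^ 2) ^ k + (v ^ 2) ^ k‖ ≤ C * q ^ k := by
    intro k hk
    have := h k (le_of_max_le_left hk)
    obtain ⟨j, hj⟩ : ∃ j, 2 * k = j + 2 :=
      ⟨2 * k - 2, by have := le_of_max_le_right hk; omega⟩
    rwa [hj, (hall j).2, ← hj, norm_neg, pow_mul, pow_mul] at this
  have hbu := norm_le_of_norm_pow_add_pow_le hq hu2
  have hbv := norm_le_of_norm_pow_add_pow_le hq (w := v ^ 2) (z := u ^ 2)
    fun k hk ↦ by rw [add_comm]; exact hu2 k hk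
  rw [norm_pow] at hbu hbv
  calc ‖a 1‖ = ‖u + v‖ := by rw [hadd, norm_neg]
  _ ≤ ‖u‖ + ‖v‖ := norm_add_le _ _
  _ ≤ √q + √q := add_le_add (Real.le_sqrt_of_sq_le hbu) (Real.le_sqrt_of_sq_le hbv)
  _ = _ := by ring

namespace MulChar

variable {F K : Type*} [Field F] [Field K] [Algebra F K]

/-- The lift of a multiplicative character along the norm of a finite extension. -/
noncomputable def compNorm [FiniteDimensional F K] (χ : MulChar F ℂ) : MulChar K ℂ :=
  { χ.toMonoidHom.comp (Algebra.norm F (S := K)) with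
    map_nonunit' := fun x hx ↦ by
      have : x = 0 := by simpa using hx
      simp [this, Algebra.norm_zero] }

theorem compNorm_apply [FiniteDimensional F K] (χ : MulChar F ℂ) (x : K) :
    χ.compNorm x = χ (Algebra.norm F x) := rfl

theorem compNorm_ne_one [Finite F] [Finite K] {χ : MulChar F ℂ} (hχ : χ ≠ 1) :
    χ.compNorm (K := K) ≠ 1 := by
  obtain ⟨u, hu⟩ := ne_one_iff.1 hχ
  obtain ⟨x, hx⟩ := FiniteField.norm_surjective F K u
  have hx0 : x ≠ 0 := by
    rintro rfl
    rw [Algebra.norm_zero] at hx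
    exact u.ne_zero hx.symm
  refine ne_one_iff.2 ⟨Units.mk0 x hx0, ?_⟩
  rwa [compNorm_apply, Units.val_mk0, hx]

theorem compNorm_pow_eq_one [FiniteDimensional F K] {χ : MulChar F ℂ} {d : ℕ} (h : χ ^ d = 1) :
    χ.compNorm (K := K) ^ d = 1 := by
  ext x
  have hN : Algebra.norm F (x : K) ≠ 0 := Algebra.norm_ne_zero_iff.2 x.ne_zero
  rw [pow_apply_coe, compNorm_apply, one_apply_coe]
  have := DFunLike.congr_fun h (Units.mk0 _ hN : F)
  rwa [pow_apply_coe, one_apply_coe] at this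

/-- The completely multiplicative function on polynomials attached to the values of `χ`, `χ⁻¹`,
`χ⁻¹` at three points. -/
noncomputable def threePoint (χ : MulChar F ℂ) (α β γ : F) : F[X] →* ℂ where
  toFun g := χ (g.eval α) * χ⁻¹ (g.eval β) * χ⁻¹ (g.eval γ)
  map_one' := by simp
  map_mul' g h := by simp only [eval_mul, map_mul]; ring

theorem threePoint_apply (χ : MulChar F ℂ) (α β γ : F) (g : F[X]) :
    χ.threePoint α β γ g = χ (g.eval α) * χ⁻¹ (g.eval β) * χ⁻¹ (g.eval γ) := rfl

theorem sum_threePoint_eq_zero [Fintype F] {χ : MulChar F ℂ} (hχ : χ ≠ 1) {α β γ : F}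
    (hβ : α ≠ β) (hγ : α ≠ γ) {n : ℕ} (hn : 3 ≤ n) :
    ∑ g ∈ monicOfNatDegree F n, χ.threePoint α β γ g = 0 := by
  set T := ∑ g ∈ monicOfNatDegree F n, χ.threePoint α β γ g with hT
  set u : F[X] := (X - C β) * (X - C γ) with hu
  have hdeg : ∀ c : F, (C c * u).natDegree < n := fun c ↦ by
    refine lt_of_le_of_lt (natDegree_C_mul_le c u) ?_
    rw [hu, natDegree_mul (X_sub_C_ne_zero _) (X_sub_C_ne_zero _), natDegree_X_sub_C,
      natDegree_X_sub_C]
    omega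
  have hmem : ∀ c : F, ∀ g ∈ monicOfNatDegree F n, g + C c * u ∈ monicOfNatDegree F n := by
    intro c g hg
    rw [mem_monicOfNatDegree] at hg ⊢
    have hlt : (C c * u).natDegree < g.natDegree := by rw [hg.2]; exact hdeg c
    exact ⟨hg.1.add_of_left (degree_lt_degree hlt),
      (natDegree_add_eq_left_of_natDegree_lt hlt).trans hg.2⟩
  have hshift : ∀ c : F, ∑ g ∈ monicOfNatDegree F n, χ.threePoint α β γ (g + C c * u) = T := by
    intro c
    refine sum_nbij' (fun g ↦ g + C c * u) (fun g ↦ g + C (-c) * u) (hmem c) (hmem (-c)) ?_ ?_ ?_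
    · intro g _; simp
    · intro g _; simp
    · intro g _; rfl
  have hδ : u.eval α ≠ 0 := by
    simp [hu, sub_ne_zero, hβ, hγ]
  have hsum : ∑ c : F, ∑ g ∈ monicOfNatDegree F n, χ.threePoint α β γ (g + C c * u) = 0 := by
    rw [sum_comm]
    refine sum_eq_zero fun g _ ↦ ?_
    have h1 : ∀ c : F, χ.threePoint α β γ (g + C c * u) =
        χ (g.eval α + c * u.eval α) * (χ⁻¹ (g.eval β) * χ⁻¹ (g.eval γ)) := by
      intro c
      rw [threePoint_apply]
      simp [hu, mul_assoc]
    rw [sum_congr rfl fun c _ ↦ h1 c, ← sum_mul]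
    have h2 : ∑ c : F, χ (g.eval α + c * u.eval α) = ∑ c : F, χ c :=
      ((Equiv.mulRight₀ _ hδ).trans (Equiv.addLeft (g.eval α))).sum_comp (fun c ↦ χ c)
    rw [h2, sum_eq_zero_of_ne_one hχ, zero_mul]
  rw [sum_congr rfl fun c _ ↦ hshift c, sum_const, nsmul_eq_mul, mul_eq_zero] at hsum
  refine hsum.resolve_left ?_
  simp

end MulChar

theorem norm_sum_three_mulChar_le {p : ℕ} [Fact p.Prime] {χ : MulChar (ZMod p) ℂ} (hχ : χ ≠ 1)
    {α β γ : ZMod p} (hβ : α ≠ β) (hγ : α ≠ γ) :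
    ‖∑ x, χ (α - x) * χ⁻¹ (β - x) * χ⁻¹ (γ - x)‖ ≤ 2 * √p := by
  set W := χ.threePoint α β γ with hW
  have hp : p.Prime := Fact.out
  set d := orderOf χ with hd
  have hd0 : 0 < d := orderOf_pos χ
  have hd1 : d ≠ 1 := fun h ↦ hχ (orderOf_eq_one_iff.1 h)
  have hdp : d ∣ p - 1 := by
    simpa [ZMod.card] using χ.orderOf_dvd_card_sub_one
  have hχd : χ ^ d = 1 := pow_orderOf_eq_one χ
  have hinv : χ⁻¹ = χ ^ (d - 1) := by
    rw [inv_eq_iff_mul_eq_one, ← pow_succ', Nat.sub_add_cancel hd0, hχd]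
  have h1 : ∑ x, χ (α - x) * χ⁻¹ (β - x) * χ⁻¹ (γ - x) =
      ∑ g ∈ monicOfNatDegree (ZMod p) 1, W g := by
    refine sum_nbij (fun x ↦ X - C x) ?_ ?_ ?_ ?_
    · intro x _
      exact mem_monicOfNatDegree.2 ⟨monic_X_sub_C x, natDegree_X_sub_C x⟩
    · intro x _ y _ h
      exact C_injective (sub_right_injective h)
    · intro g hg
      obtain ⟨hm, h⟩ := mem_monicOfNatDegree.1 (mem_coe.1 hg)
      refine ⟨-g.coeff 0, mem_coe.2 (mem_univ _), ?_⟩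
      rw [hm.eq_X_add_C h]; simp
    · intro x _
      simp [hW, MulChar.threePoint_apply]
  rw [h1]
  refine norm_le_two_mul_sqrt_of_newton (S := primePowerSum W)
    (a := fun n ↦ ∑ g ∈ monicOfNatDegree (ZMod p) n, W g) ?_ ?_ ?_
    (C := d * (3 * (2 * d - 1 : ℕ) + 4) + (2 * d - 1 : ℕ))
    (k₀ := d * (2 * (2 * d - 1) + 4) + 1) (by exact_mod_cast hp.pos) ?_
  · have : monicOfNatDegree (ZMod p) 0 = {1} := by
      ext g
      rw [mem_monicOfNatDegree, mem_singleton]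
      exact ⟨fun h ↦ h.1.natDegree_eq_zero.1 h.2, fun h ↦ h ▸ ⟨monic_one, natDegree_one⟩⟩
    rw [this, sum_singleton, map_one]
  · exact fun n hn ↦ MulChar.sum_threePoint_eq_zero hχ hβ hγ hn
  · exact natCast_mul_sum_monicOfNatDegree W
  · intro k hk
    have hk0 : 2 * k ≠ 0 := by omega
    let K := GaloisField p (2 * k)
    have : Fintype K := Fintype.ofFinite K
    have hcard : Fintype.card K = (p ^ k) ^ 2 := by
      rw [← Nat.card_eq_fintype_card, GaloisField.card p _ hk0, ← pow_mul, mul_comm]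
    have hrank : Module.finrank (ZMod p) K = 2 * k := GaloisField.finrank p hk0
    let θ : MulChar K ℂ := χ.compNorm
    let a := algebraMap (ZMod p) K
    set f : K[X] := (C (a α) - X) * (C (a β) - X) ^ (d - 1) * (C (a γ) - X) ^ (d - 1) with hf
    have hlin : ∀ b : K, C b - X ≠ 0 ∧ (C b - X).natDegree = 1 := fun b ↦ by
      rw [← neg_sub, neg_ne_zero, natDegree_neg]
      exact ⟨X_sub_C_ne_zero b, natDegree_X_sub_C b⟩
    have hf0 : f ≠ 0 :=
      mul_ne_zero (mul_ne_zero (hlin _).1 (pow_ne_zero _ (hlin _).1)) (pow_ne_zero _ (hlin _).1)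
    have hfdeg : f.natDegree = 2 * d - 1 := by
      rw [hf, natDegree_mul (mul_ne_zero (hlin _).1 (pow_ne_zero _ (hlin _).1))
        (pow_ne_zero _ (hlin _).1), natDegree_mul (hlin _).1 (pow_ne_zero _ (hlin _).1),
        natDegree_pow, natDegree_pow, (hlin _).2, (hlin _).2, (hlin _).2]
      omega
    have hS : primePowerSum W (2 * k) = ∑ x : K, θ (f.eval x) := by
      refine (congrArg _ hrank.symm).trans (sum_minpoly_pow_eq_primePowerSum W).symm |>.trans ?_
      refine sum_congr rfl fun x _ ↦ ?_
      rw [← map_pow, hW, MulChar.threePoint_apply, eval_pow, eval_pow, eval_pow,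
        ← norm_algebraMap_sub, ← norm_algebraMap_sub, ← norm_algebraMap_sub, hinv,
        MulChar.pow_apply' _ (by omega), MulChar.pow_apply' _ (by omega), hf]
      simp only [eval_mul, eval_pow, eval_sub, eval_C, eval_X, map_mul, map_pow, θ,
        MulChar.compNorm_apply, a]
    rw [hS]
    have hcop : Nat.Coprime (2 * d - 1) d := by
      rw [show 2 * d - 1 = (d - 1) + d by omega, Nat.coprime_add_self_left]
      have := Nat.coprime_self_sub_left (m := 1) (n := d) (by omega)
      rw [this]; exact Nat.coprime_one_left d
    have hkp : k ≤ p ^ k := (Nat.lt_pow_self hp.one_lt).le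
    have := norm_sum_mulChar_eval_le_mul_sqrt (K := K) (p := p) (k := k) rfl hcard
      (d := d) (by omega) (hdp.trans (by simpa using Nat.sub_dvd_pow_sub_pow p 1 k))
      (MulChar.compNorm_ne_one hχ) (MulChar.compNorm_pow_eq_one hχd) hf0 (hfdeg ▸ hcop)
      (by rw [hfdeg]; omega)
    rw [hfdeg] at this
    exact_mod_cast this

section fourthMoment

theorem sum_eq_sum_inv_sub {F : Type*} [Field F] [Fintype F] {f g : F → ℂ} (a : F)
    (hf : f (-a) = 0) (h : ∀ u ≠ 0, f (u⁻¹ - a) = g u) : ∑ x, f x = ∑ u, g u - g 0 := by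
  classical
  have h1 : ∑ x, f x = ∑ u, f (u⁻¹ - a) :=
    (((Equiv.inv F).trans (Equiv.subRight a)).sum_comp f).symm
  rw [h1, ← sum_erase_add _ _ (mem_univ 0), ← sum_erase_add (a := (0 : F)) univ g (mem_univ 0)]
  rw [inv_zero, zero_sub, hf, add_zero, add_sub_cancel_right]
  exact sum_congr rfl fun u hu ↦ h u (ne_of_mem_erase hu)

theorem norm_sum_two_mulChar_le {F : Type*} [Field F] [Fintype F] {χ : MulChar F ℂ} (hχ : χ ≠ 1)
    {a b : F} (hab : a ≠ b) : ‖∑ x, χ (x + a) * χ⁻¹ (x + b)‖ ≤ 1 := by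
  rw [sum_eq_sum_inv_sub (g := fun u ↦ χ (1 + u * (a - b))) b (by simp [MulChar.map_zero])
    fun u hu ↦ ?_]
  · have : ∑ u, χ (1 + u * (a - b)) = ∑ u, χ u :=
      ((Equiv.mulRight₀ _ (sub_ne_zero.2 hab)).trans (Equiv.addLeft 1)).sum_comp (fun c ↦ χ c)
    simp [this, MulChar.sum_eq_zero_of_ne_one hχ]
  · rw [MulChar.inv_apply', ← map_mul]
    congr 1
    field_simp
    ring

variable {p : ℕ} [Fact p.Prime] {χ : MulChar (ZMod p) ℂ}

/-- The correlation sum of two shifts of `χ` with two shifts of `χ⁻¹`. -/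
noncomputable def fourPointSum (χ : MulChar (ZMod p) ℂ) (a b c d : ZMod p) : ℂ :=
  ∑ x, χ (x + a) * χ (x + b) * χ⁻¹ (x + c) * χ⁻¹ (x + d)

theorem star_fourPointSum (a b c d : ZMod p) :
    star (fourPointSum χ a b c d) = fourPointSum χ c d a b := by
  rw [fourPointSum, fourPointSum, star_sum]
  refine sum_congr rfl fun x _ ↦ ?_
  simp only [star_mul', MulChar.star_apply', inv_inv]
  ring

theorem norm_fourPointSum_le_card (a b c d : ZMod p) : ‖fourPointSum χ a b c d‖ ≤ p := by
  refine (norm_sum_le _ _).trans ((sum_le_card_nsmul univ _ 1 fun x _ ↦ ?_).trans_eq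
    (by simp [ZMod.card]))
  rw [norm_mul, norm_mul, norm_mul]
  have h := fun (ψ : MulChar (ZMod p) ℂ) y ↦ norm_mulChar_apply_le_one ψ y
  exact mul_le_one₀ (mul_le_one₀ (mul_le_one₀ (h _ _) (norm_nonneg _) (h _ _)) (norm_nonneg _)
    (h _ _)) (norm_nonneg _) (h _ _)

theorem norm_fourPointSum_cancel_le (hχ : χ ≠ 1) {a b d : ZMod p} (hbd : b ≠ d) :
    ‖fourPointSum χ a b a d‖ ≤ 2 := by
  have h1 : fourPointSum χ a b a d =
      ∑ x, χ (x + b) * χ⁻¹ (x + d) - χ (-a + b) * χ⁻¹ (-a + d) := by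
    rw [fourPointSum, ← sum_erase_add univ _ (mem_univ (-a)),
      ← sum_erase_add univ (fun x ↦ χ (x + b) * χ⁻¹ (x + d)) (mem_univ (-a))]
    simp only [neg_add_cancel, MulChar.map_zero, zero_mul, add_zero, add_sub_cancel_right]
    refine sum_congr rfl fun x hx ↦ ?_
    have hne : x + a ≠ 0 := fun h ↦ ne_of_mem_erase hx (eq_neg_of_add_eq_zero_left h)
    have h2 : χ (x + a) * χ⁻¹ (x + a) = 1 := by
      rw [← MulChar.mul_apply, mul_inv_cancel, MulChar.one_apply hne.isUnit]
    linear_combination (χ (x + b) * χ⁻¹ (x + d)) * h2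
  rw [h1]
  refine (norm_sub_le _ _).trans ?_
  rw [norm_mul]
  have := mul_le_one₀ (norm_mulChar_apply_le_one χ (-a + b)) (norm_nonneg _)
    (norm_mulChar_apply_le_one χ⁻¹ (-a + d))
  linarith [norm_sum_two_mulChar_le hχ hbd]

theorem norm_fourPointSum_le_of_ne (hχ : χ ≠ 1) {a b c d : ZMod p} (hab : a ≠ b) (hac : a ≠ c)
    (had : a ≠ d) (hbc : b ≠ c) (hbd : b ≠ d) : ‖fourPointSum χ a b c d‖ ≤ 2 * √p + 1 := by
  have hba := sub_ne_zero.2 hab.symm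
  have hca := sub_ne_zero.2 hac.symm
  have hda := sub_ne_zero.2 had.symm
  rw [fourPointSum, sum_eq_sum_inv_sub
    (g := fun u ↦ χ (1 + u * (b - a)) * χ⁻¹ (1 + u * (c - a)) * χ⁻¹ (1 + u * (d - a))) a
    (by simp [MulChar.map_zero χ]) fun u hu ↦ ?_]
  · refine (norm_sub_le _ _).trans (add_le_add ?_ (by simp))
    have h1 : ∑ u, χ (1 + u * (b - a)) * χ⁻¹ (1 + u * (c - a)) * χ⁻¹ (1 + u * (d - a)) =
        χ (b - a) * χ⁻¹ (c - a) * χ⁻¹ (d - a) * ∑ x, χ ((b - a)⁻¹ - x) * χ⁻¹ ((c - a)⁻¹ - x) *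
          χ⁻¹ ((d - a)⁻¹ - x) := by
      rw [mul_sum, ← Equiv.sum_comp (Equiv.neg (ZMod p))]
      refine sum_congr rfl fun x _ ↦ ?_
      have e : ∀ (ψ : MulChar (ZMod p) ℂ) (y : ZMod p), y ≠ 0 →
          ψ (1 + -x * y) = ψ y * ψ (y⁻¹ - x) := fun ψ y hy ↦ by
        rw [← map_mul, mul_sub, mul_inv_cancel₀ hy]; ring_nf
      rw [Equiv.neg_apply, e _ _ hba, e _ _ hca, e _ _ hda]
      ring
    rw [h1, norm_mul, norm_mul, norm_mul]
    have h := fun (ψ : MulChar (ZMod p) ℂ) y ↦ norm_mulChar_apply_le_one ψ y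
    have hinv : ∀ {y z : ZMod p}, y ≠ z → (y - a)⁻¹ ≠ (z - a)⁻¹ := fun hyz h ↦
      hyz (sub_left_injective (inv_injective h))
    calc _ ≤ 1 * (2 * √p) := by
          gcongr
          · exact mul_le_one₀ (mul_le_one₀ (h _ _) (norm_nonneg _) (h _ _)) (norm_nonneg _) (h _ _)
          · exact norm_sum_three_mulChar_le hχ (hinv hbc) (hinv hbd)
    _ = _ := one_mul _
  · have e : ∀ (ψ : MulChar (ZMod p) ℂ) (y : ZMod p),
        ψ (1 + u * (y - a)) = ψ u * ψ (u⁻¹ - a + y) := fun ψ y ↦ by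
      rw [← map_mul]
      congr 1
      field_simp
      ring
    have h1 : χ u * χ (u⁻¹ - a + a) = 1 := by rw [← e]; simp
    have h2 : χ u * χ⁻¹ u = 1 := by
      rw [← MulChar.mul_apply, mul_inv_cancel, MulChar.one_apply hu.isUnit]
    have h3 : χ (u⁻¹ - a + a) = χ⁻¹ u := by
      rw [sub_add_cancel, MulChar.inv_apply']
    simp only [e]
    rw [h3]
    linear_combination (-(χ⁻¹ u * χ (u⁻¹ - a + b) * χ⁻¹ (u⁻¹ - a + c) * χ⁻¹ (u⁻¹ - a + d))) * h2

theorem norm_fourPointSum_le (hχ : χ ^ 2 ≠ 1) {a b c d : ZMod p}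
    (h₁ : ¬(a = c ∧ b = d)) (h₂ : ¬(a = d ∧ b = c)) :
    ‖fourPointSum χ a b c d‖ ≤ 2 * √p + 1 := by
  have hχ1 : χ ≠ 1 := by rintro rfl; simp at hχ
  have hp : (2 : ℝ) ≤ 2 * √p + 1 := by
    have : 1 ≤ √(p : ℝ) := Real.one_le_sqrt.2 (by exact_mod_cast (Fact.out : p.Prime).one_le)
    linarith
  have comm₁ : ∀ a b c d, fourPointSum χ a b c d = fourPointSum χ b a c d := fun a b c d ↦
    sum_congr rfl fun x _ ↦ by ring
  have comm₂ : ∀ a b c d, fourPointSum χ a b c d = fourPointSum χ a b d c := fun a b c d ↦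
    sum_congr rfl fun x _ ↦ by ring
  by_cases hac : a = c
  · subst hac
    exact (norm_fourPointSum_cancel_le hχ1 (by tauto)).trans hp
  by_cases had : a = d
  · subst had
    rw [comm₂]
    exact (norm_fourPointSum_cancel_le hχ1 (by tauto)).trans hp
  by_cases hbc : b = c
  · subst hbc
    rw [comm₁]
    exact (norm_fourPointSum_cancel_le hχ1 (by tauto)).trans hp
  by_cases hbd : b = d
  · subst hbd
    rw [comm₁, comm₂]
    exact (norm_fourPointSum_cancel_le hχ1 (by tauto)).trans hp
  by_cases hab : a = b
  · by_cases hcd : c = d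
    · subst hab hcd
      have : fourPointSum χ a a c c = ∑ x, (χ ^ 2) (x + a) * (χ ^ 2)⁻¹ (x + c) := by
        refine sum_congr rfl fun x _ ↦ ?_
        rw [sq, mul_inv, MulChar.mul_apply, MulChar.mul_apply]; ring
      rw [this]
      exact (norm_sum_two_mulChar_le hχ hac).trans (by linarith)
    · rw [← norm_star, star_fourPointSum]
      exact norm_fourPointSum_le_of_ne hχ1 hcd (Ne.symm hac) (Ne.symm hbc) (Ne.symm had)
        (Ne.symm hbd)
  · exact norm_fourPointSum_le_of_ne hχ1 hab hac had hbc hbd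

theorem sum_norm_sum_mulChar_pow_four_le (hχ : χ ^ 2 ≠ 1) (s : Finset (ZMod p)) :
    ∑ x, ‖∑ b ∈ s, χ (x + b)‖ ^ 4 ≤ 2 * (#s : ℝ) ^ 2 * p + (2 * √p + 1) * (#s : ℝ) ^ 4 := by
  have h1 : ∀ x, ((‖∑ b ∈ s, χ (x + b)‖ ^ 4 : ℝ) : ℂ) = ∑ a ∈ s, ∑ b ∈ s, ∑ c ∈ s, ∑ d ∈ s,
      χ (x + a) * χ (x + b) * χ⁻¹ (x + c) * χ⁻¹ (x + d) := by
    intro x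
    set z := ∑ b ∈ s, χ (x + b) with hz
    have hs : star z = ∑ b ∈ s, χ⁻¹ (x + b) := by
      simp only [hz, star_sum, MulChar.star_apply']
    have h2 : ((‖z‖ ^ 2 : ℝ) : ℂ) = z * star z := by
      rw [Complex.star_def, Complex.mul_conj, Complex.normSq_eq_norm_sq]
    rw [show ‖z‖ ^ 4 = ‖z‖ ^ 2 * ‖z‖ ^ 2 by ring, Complex.ofReal_mul, h2,
      show z * star z * (z * star z) = star z * star z * z * z by ring, hs, hz]
    simp only [sum_mul, mul_sum]
    refine sum_congr rfl fun a _ ↦ sum_congr rfl fun b _ ↦ sum_congr rfl fun c _ ↦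
      sum_congr rfl fun d _ ↦ by ring
  have h2 : ((∑ x, ‖∑ b ∈ s, χ (x + b)‖ ^ 4 : ℝ) : ℂ) = ∑ a ∈ s, ∑ b ∈ s, ∑ c ∈ s, ∑ d ∈ s,
      fourPointSum χ a b c d := by
    rw [Complex.ofReal_sum, sum_congr rfl fun x _ ↦ h1 x, sum_comm]
    refine sum_congr rfl fun a _ ↦ ?_
    rw [sum_comm]
    refine sum_congr rfl fun b _ ↦ ?_
    rw [sum_comm]
    refine sum_congr rfl fun c _ ↦ ?_
    rw [sum_comm]
    rfl
  calc _ = ‖((∑ x, ‖∑ b ∈ s, χ (x + b)‖ ^ 4 : ℝ) : ℂ)‖ := by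
        rw [Complex.norm_real, Real.norm_of_nonneg (by positivity)]
  _ ≤ ∑ a ∈ s, ∑ b ∈ s, ∑ c ∈ s, ∑ d ∈ s, ‖fourPointSum χ a b c d‖ := by
    rw [h2]
    refine (norm_sum_le _ _).trans (sum_le_sum fun a _ ↦ ?_)
    refine (norm_sum_le _ _).trans (sum_le_sum fun b _ ↦ ?_)
    refine (norm_sum_le _ _).trans (sum_le_sum fun c _ ↦ ?_)
    exact norm_sum_le _ _
  _ ≤ ∑ a ∈ s, ∑ b ∈ s, ∑ c ∈ s, ∑ d ∈ s, ((if a = c then if b = d then (p : ℝ) else 0 else 0) +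
      (if b = c then if a = d then (p : ℝ) else 0 else 0) + (2 * √p + 1)) := by
    refine sum_le_sum fun a _ ↦ sum_le_sum fun b _ ↦ sum_le_sum fun c _ ↦ sum_le_sum fun d _ ↦ ?_
    have hp : 0 ≤ 2 * √(p : ℝ) + 1 := by positivity
    have hp' : (0 : ℝ) ≤ p := by positivity
    have h0 := norm_fourPointSum_le_card (χ := χ) a b c d
    by_cases h₁ : a = c ∧ b = d
    · rw [if_pos h₁.1, if_pos h₁.2]
      split_ifs <;> linarith
    by_cases h₂ : a = d ∧ b = c
    · rw [if_pos h₂.2, if_pos h₂.1]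
      split_ifs <;> linarith
    have := norm_fourPointSum_le hχ h₁ h₂
    split_ifs <;> linarith
  _ = _ := by
    simp only [sum_add_distrib, sum_const, nsmul_eq_mul]
    have e1 : ∑ a ∈ s, ∑ b ∈ s, ∑ c ∈ s, ∑ d ∈ s,
        (if a = c then if b = d then (p : ℝ) else 0 else 0) = (#s : ℝ) ^ 2 * p := by
      rw [sum_congr rfl fun a ha ↦ sum_congr rfl fun b hb ↦ (by
        rw [sum_congr rfl fun c _ ↦ (by rw [sum_ite_irrel, sum_ite_eq, if_pos hb, sum_const_zero] :
          _ = if a = c then (p : ℝ) else 0), sum_ite_eq, if_pos ha] : _ = (p : ℝ))]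
      simp only [sum_const, nsmul_eq_mul]; ring
    have e2 : ∑ a ∈ s, ∑ b ∈ s, ∑ c ∈ s, ∑ d ∈ s,
        (if b = c then if a = d then (p : ℝ) else 0 else 0) = (#s : ℝ) ^ 2 * p := by
      rw [sum_congr rfl fun a ha ↦ sum_congr rfl fun b hb ↦ (by
        rw [sum_congr rfl fun c _ ↦ (by rw [sum_ite_irrel, sum_ite_eq, if_pos ha, sum_const_zero] :
          _ = if b = c then (p : ℝ) else 0), sum_ite_eq, if_pos hb] : _ = (p : ℝ))]
      simp only [sum_const, nsmul_eq_mul]; ring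
    rw [e1, e2]; ring

end fourthMoment

section congruencePairs

theorem card_Ioc_filter_dvd_le {r : ℤ} (hr : 0 < r) {a b : ℤ} (hab : a ≤ b) :
    (#{x ∈ Ioc a b | r ∣ x} : ℝ) ≤ (b - a) / r + 1 := by
  have h := Int.Ioc_filter_dvd_card a b hr
  have h1 : (#{x ∈ Ioc a b | r ∣ x} : ℚ) ≤ (b - a) / r + 1 := by
    have hr' : (0 : ℚ) < r := by exact_mod_cast hr
    have hab' : (a : ℚ) ≤ b := by exact_mod_cast hab
    rw [← Int.cast_natCast (R := ℚ), h, Int.cast_max, max_le_iff]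
    constructor
    · push_cast
      rw [sub_div]
      linarith [Int.floor_le ((b : ℚ) / r), Int.lt_floor_add_one ((a : ℚ) / r)]
    · rw [Int.cast_zero]
      have : 0 ≤ ((b : ℚ) - a) / r := div_nonneg (sub_nonneg.2 hab') hr'.le
      linarith
  exact_mod_cast h1

theorem card_Ioc_filter_modEq_le {r : ℤ} (hr : 0 < r) {a b : ℤ} (hab : a ≤ b) (v : ℤ) :
    (#{x ∈ Ioc a b | x ≡ v [ZMOD r]} : ℝ) ≤ (b - a) / r + 1 := by
  rw [Int.Ioc_filter_modEq_eq, card_map]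
  refine (card_Ioc_filter_dvd_le hr (by omega)).trans_eq ?_
  push_cast
  ring

theorem card_pairs_dvd_mul_sub_mul_le {p : ℕ} (hp : 0 < p) (N : ℤ) (H : ℕ) {x y : ℕ} (hx : 0 < x)
    (hxy : x ≤ y) (hcop : Nat.Coprime x y) :
    (#{n ∈ Ioc N (N + H) ×ˢ Ioc N (N + H) | (p : ℤ) ∣ x * n.2 - y * n.1} : ℝ) ≤
      (2 * y * H / p + 1) * (H / y + 1) := by
  classical
  set P := {n ∈ Ioc N (N + H) ×ˢ Ioc N (N + H) | (p : ℤ) ∣ x * n.2 - y * n.1} with hP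
  set T := {t ∈ Ioc (x * N - y * (N + H)) (x * (N + H) - y * N) | (p : ℤ) ∣ t} with hT
  have hx' : (0 : ℤ) < x := by exact_mod_cast hx
  have hy : 0 < y := hx.trans_le hxy
  have hy' : (0 : ℤ) < y := by exact_mod_cast hy
  have hp' : (0 : ℤ) < p := by exact_mod_cast hp
  have hmap : ∀ n ∈ P, (x * n.2 - y * n.1 : ℤ) ∈ T := by
    intro n hn
    rw [hP, mem_filter, mem_product, mem_Ioc, mem_Ioc] at hn
    obtain ⟨⟨⟨h1, h2⟩, h3, h4⟩, h5⟩ := hn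
    rw [hT, mem_filter, mem_Ioc]
    refine ⟨⟨?_, ?_⟩, h5⟩
    · nlinarith
    · nlinarith
  have hTcard : (#T : ℝ) ≤ 2 * y * H / p + 1 := by
    refine (card_Ioc_filter_dvd_le hp' (by nlinarith [Int.natCast_nonneg H])).trans ?_
    push_cast
    have : (x : ℝ) ≤ y := by exact_mod_cast hxy
    gcongr
    nlinarith [(Nat.cast_nonneg H : (0 : ℝ) ≤ H)]
  have hfib : ∀ t ∈ T, (#{n ∈ P | x * n.2 - y * n.1 = t} : ℝ) ≤ H / y + 1 := by
    intro t _
    rcases ({n ∈ P | x * n.2 - y * n.1 = t}).eq_empty_or_nonempty with h0 | ⟨m, hm⟩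
    · rw [h0, card_empty, Nat.cast_zero]; positivity
    have hm2 := (mem_filter.1 hm).2
    have hle : #{n ∈ P | x * n.2 - y * n.1 = t} ≤ #{z ∈ Ioc N (N + H) | z ≡ m.2 [ZMOD y]} := by
      refine card_le_card_of_injOn (fun n ↦ n.2) ?_ ?_
      · intro n hn
        obtain ⟨h1, h2⟩ := mem_filter.1 (mem_coe.1 hn)
        have h3 := (mem_product.1 (mem_filter.1 h1).1).2
        refine mem_coe.2 (mem_filter.2 ⟨h3, ?_⟩)
        have h4 : (y : ℤ) ∣ x * (m.2 - n.2) := ⟨m.1 - n.1, by linear_combination hm2 - h2⟩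
        exact Int.modEq_iff_dvd.2
          ((Int.isCoprime_iff_gcd_eq_one.2 (by simpa using hcop.symm)).dvd_of_dvd_mul_left h4)
      · intro n hn n' hn' h
        have h1 := (mem_filter.1 (mem_coe.1 hn)).2
        have h2 := (mem_filter.1 (mem_coe.1 hn')).2
        have h3 : n.2 = n'.2 := h
        refine Prod.ext ?_ h3
        rw [h3] at h1
        exact mul_left_cancel₀ hy'.ne' (by linarith)
    calc (#{n ∈ P | x * n.2 - y * n.1 = t} : ℝ) ≤ #{z ∈ Ioc N (N + H) | z ≡ m.2 [ZMOD y]} := by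
          exact_mod_cast hle
    _ ≤ _ := (card_Ioc_filter_modEq_le hy' (by omega) _).trans_eq (by push_cast; ring)
  rw [card_eq_sum_card_fiberwise (f := fun n : ℤ × ℤ ↦ x * n.2 - y * n.1) hmap, Nat.cast_sum]
  refine (sum_le_card_nsmul _ _ _ hfib).trans ?_
  rw [nsmul_eq_mul]
  gcongr

theorem card_pairs_dvd_le {p : ℕ} (hp : p.Prime) (N : ℤ) (H : ℕ) {a b : ℕ} (ha : 0 < a)
    (hab : a ≤ b) (hb : b < p) :
    (#{n ∈ Ioc N (N + H) ×ˢ Ioc N (N + H) | (p : ℤ) ∣ a * n.2 - b * n.1} : ℝ) ≤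
      2 * H ^ 2 / p + 2 * b * H / p + 1 + H * (a.gcd b / b) := by
  set g := a.gcd b with hg
  have hg0 : 0 < g := Nat.gcd_pos_of_pos_left b ha
  obtain ⟨x, hx⟩ : g ∣ a := Nat.gcd_dvd_left a b
  obtain ⟨y, hy⟩ : g ∣ b := Nat.gcd_dvd_right a b
  have hcop : Nat.Coprime x y := by
    have := Nat.coprime_div_gcd_div_gcd (m := a) (n := b) hg0
    rwa [← hg, Nat.div_eq_of_eq_mul_right hg0 hx, Nat.div_eq_of_eq_mul_right hg0 hy] at this
  have hx0 : 0 < x := Nat.pos_of_mul_pos_left (hx ▸ ha)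
  have hxy : x ≤ y := Nat.le_of_mul_le_mul_left (hx ▸ hy ▸ hab) hg0
  have hpg : ¬ (p : ℤ) ∣ g := by
    rw [Int.natCast_dvd_natCast]
    exact Nat.not_dvd_of_pos_of_lt hg0
      (((Nat.gcd_le_left b ha).trans hab).trans_lt hb)
  have hP : {n ∈ Ioc N (N + H) ×ˢ Ioc N (N + H) | (p : ℤ) ∣ a * n.2 - b * n.1} =
      {n ∈ Ioc N (N + H) ×ˢ Ioc N (N + H) | (p : ℤ) ∣ x * n.2 - y * n.1} := by
    refine filter_congr fun n _ ↦ ?_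
    have : (a * n.2 - b * n.1 : ℤ) = g * (x * n.2 - y * n.1) := by
      rw [hx, hy]; push_cast; ring
    rw [this, (Nat.prime_iff_prime_int.1 hp).dvd_mul, or_iff_right hpg]
  rw [hP]
  refine (card_pairs_dvd_mul_sub_mul_le hp.pos N H hx0 hxy hcop).trans ?_
  have hy0 : (0 : ℝ) < y := by exact_mod_cast hx0.trans_le hxy
  have hg0' : (0 : ℝ) < g := by exact_mod_cast hg0
  have hb' : (b : ℝ) = g * y := by exact_mod_cast hy
  have hp0 : (0 : ℝ) < p := by exact_mod_cast hp.pos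
  have hyb : (y : ℝ) ≤ b := by
    exact_mod_cast Nat.le_of_dvd (ha.trans_le hab) ⟨g, by rw [mul_comm]; exact hy⟩
  have e1 : (g : ℝ) / b = 1 / y := by rw [hb']; field_simp
  have e2 : (2 * y * H / p + 1) * (H / y + 1) =
      2 * (H : ℝ) ^ 2 / p + 2 * y * H / p + 1 + H * (1 / y) := by field_simp; ring
  rw [e1, e2]
  gcongr

theorem sum_gcd_le (b : ℕ) : ∑ a ∈ Ioc 0 b, a.gcd b ≤ b * #b.divisors := by
  rcases Nat.eq_zero_or_pos b with rfl | hb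
  · simp
  calc ∑ a ∈ Ioc 0 b, a.gcd b ≤ ∑ a ∈ Ioc 0 b, ∑ d ∈ b.divisors, if d ∣ a then d else 0 := by
        refine sum_le_sum fun a _ ↦ ?_
        refine le_trans ?_ (single_le_sum (fun _ _ ↦ Nat.zero_le _)
          (Nat.mem_divisors.2 ⟨Nat.gcd_dvd_right a b, hb.ne'⟩))
        rw [if_pos (Nat.gcd_dvd_left a b)]
  _ = ∑ d ∈ b.divisors, b := by
    rw [sum_comm]
    refine sum_congr rfl fun d hd ↦ ?_
    rw [← sum_filter, sum_const, Nat.Ioc_filter_dvd_card_eq_div, smul_eq_mul,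
      Nat.div_mul_cancel (Nat.dvd_of_mem_divisors hd)]
  _ = _ := by rw [sum_const, smul_eq_mul, mul_comm]

theorem sum_sum_gcd_div_le (A : ℕ) :
    ∑ b ∈ Ioc 0 A, ∑ a ∈ Ioc 0 A, (if a ≤ b then (a.gcd b / b : ℝ) else 0) ≤
      A * (1 + Real.log A) := by
  calc _ ≤ ∑ b ∈ Ioc 0 A, (#b.divisors : ℝ) := by
        refine sum_le_sum fun b hb ↦ ?_
        have hb0 : (0 : ℝ) < b := by exact_mod_cast (mem_Ioc.1 hb).1
        rw [← sum_filter]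
        have : {a ∈ Ioc 0 A | a ≤ b} = Ioc 0 b := by
          ext a
          have := (mem_Ioc.1 hb).2
          simp only [mem_filter, mem_Ioc]
          omega
        rw [this, ← sum_div, div_le_iff₀ hb0, mul_comm]
        exact_mod_cast sum_gcd_le b
  _ = ∑ d ∈ Ioc 0 A, ((A / d : ℕ) : ℝ) := by
    have := ArithmeticFunction.sum_Ioc_sigma0_eq_sum_div A
    simp only [ArithmeticFunction.sigma_zero_apply] at this
    exact_mod_cast this
  _ ≤ ∑ d ∈ Ioc 0 A, (A : ℝ) * (d : ℝ)⁻¹ := by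
    refine sum_le_sum fun d _ ↦ ?_
    rw [← div_eq_mul_inv]
    exact Nat.cast_div_le
  _ = A * (harmonic A : ℝ) := by
    rw [← mul_sum, harmonic_eq_sum_Icc]
    push_cast
    rfl
  _ ≤ _ := by
    gcongr
    exact harmonic_le_one_add_log A

theorem sum_card_pairs_dvd_le {p : ℕ} (hp : p.Prime) (N : ℤ) (H : ℕ) {A : ℕ} (hA : A < p) :
    ∑ a ∈ Ioc 0 A, ∑ b ∈ Ioc 0 A,
      (#{n ∈ Ioc N (N + H) ×ˢ Ioc N (N + H) | (p : ℤ) ∣ a * n.2 - b * n.1} : ℝ) ≤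
      A ^ 2 * (2 * H ^ 2 / p + 2 * A * H / p + 1) + 2 * H * (A * (1 + Real.log A)) := by
  set G : ℕ → ℕ → ℝ := fun a b ↦ if a ≤ b then (a.gcd b / b : ℝ) else 0 with hG
  have hG0 : ∀ a b, 0 ≤ G a b := fun a b ↦ by
    simp only [hG]; split_ifs <;> positivity
  have hle : ∀ a ∈ Ioc 0 A, ∀ b ∈ Ioc 0 A, a ≤ b →
      (#{n ∈ Ioc N (N + H) ×ˢ Ioc N (N + H) | (p : ℤ) ∣ a * n.2 - b * n.1} : ℝ) ≤
      2 * H ^ 2 / p + 2 * A * H / p + 1 + H * G a b := by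
    intro a ha b hb hab
    rw [mem_Ioc] at ha hb
    refine (card_pairs_dvd_le hp N H ha.1 hab (hb.2.trans_lt hA)).trans ?_
    simp only [hG, if_pos hab]
    have : (b : ℝ) ≤ A := by exact_mod_cast hb.2
    gcongr
  have hsymm : ∀ a b : ℕ, #{n ∈ Ioc N (N + H) ×ˢ Ioc N (N + H) | (p : ℤ) ∣ a * n.2 - b * n.1} =
      #{n ∈ Ioc N (N + H) ×ˢ Ioc N (N + H) | (p : ℤ) ∣ b * n.2 - a * n.1} := by
    intro a b
    refine card_nbij' Prod.swap Prod.swap ?_ ?_ (fun _ _ ↦ rfl) (fun _ _ ↦ rfl) <;>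
    · intro n hn
      simp only [coe_filter, mem_product, Set.mem_ofPred_eq, Prod.fst_swap, Prod.snd_swap] at hn ⊢
      exact ⟨hn.1.symm, (dvd_neg.2 hn.2).trans (by rw [neg_sub])⟩
  calc _ ≤ ∑ a ∈ Ioc 0 A, ∑ b ∈ Ioc 0 A,
        ((2 * H ^ 2 / p + 2 * A * H / p + 1 : ℝ) + (H * G a b + H * G b a)) := by
        refine sum_le_sum fun a ha ↦ sum_le_sum fun b hb ↦ ?_
        have h1 := mul_nonneg (Nat.cast_nonneg H : (0 : ℝ) ≤ H) (hG0 a b)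
        have h2 := mul_nonneg (Nat.cast_nonneg H : (0 : ℝ) ≤ H) (hG0 b a)
        rcases le_total a b with hab | hab
        · linarith [hle a ha b hb hab]
        · rw [hsymm]
          linarith [hle b hb a ha hab]
  _ = A ^ 2 * (2 * H ^ 2 / p + 2 * A * H / p + 1) +
      2 * H * ∑ b ∈ Ioc 0 A, ∑ a ∈ Ioc 0 A, G a b := by
    simp only [sum_add_distrib, sum_const, Nat.card_Ioc, Nat.sub_zero, nsmul_eq_mul, ← mul_sum]
    rw [sum_comm (f := fun a b ↦ G a b)]
    ring
  _ ≤ _ := by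
    gcongr
    exact sum_sum_gcd_div_le A

end congruencePairs

theorem sum_comp_pow_four_le {ι α : Type*} [Fintype α] [DecidableEq α] (P : Finset ι) (φ : ι → α)
    (f : α → ℝ) :
    (∑ i ∈ P, f (φ i)) ^ 4 ≤
      (#P : ℝ) ^ 2 * #{q ∈ P ×ˢ P | φ q.1 = φ q.2} * ∑ x, f x ^ 4 := by
  set ν : α → ℝ := fun x ↦ #{i ∈ P | φ i = x} with hν
  have h1 : (∑ i ∈ P, f (φ i)) ^ 2 ≤ #P * ∑ i ∈ P, f (φ i) ^ 2 := sq_sum_le_card_mul_sum_sq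
  have h2 : ∑ i ∈ P, f (φ i) ^ 2 = ∑ x, ν x * f x ^ 2 := by
    rw [← sum_fiberwise P φ]
    refine sum_congr rfl fun x _ ↦ ?_
    rw [sum_congr rfl (g := fun _ ↦ f x ^ 2) fun i hi ↦ by rw [(mem_filter.1 hi).2], sum_const,
      nsmul_eq_mul]
  have h3 : (∑ x, ν x * f x ^ 2) ^ 2 ≤ (∑ x, ν x ^ 2) * ∑ x, (f x ^ 2) ^ 2 :=
    sum_mul_sq_le_sq_mul_sq _ _ _
  have h4 : ∑ x, ν x ^ 2 = #{q ∈ P ×ˢ P | φ q.1 = φ q.2} := by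
    rw [card_eq_sum_card_fiberwise (f := fun q : ι × ι ↦ φ q.1) (t := univ)
      fun _ _ ↦ mem_coe.2 (mem_univ _)]
    push_cast
    refine sum_congr rfl fun x _ ↦ ?_
    change (#{i ∈ P | φ i = x} : ℝ) ^ 2 = _
    rw [sq]
    norm_cast
    rw [← card_product]
    congr 1
    ext q
    simp only [mem_product, mem_filter]
    constructor
    · rintro ⟨⟨h1, rfl⟩, h2, h3⟩
      exact ⟨⟨⟨h1, h2⟩, h3.symm⟩, rfl⟩
    · rintro ⟨⟨⟨h1, h2⟩, h3⟩, rfl⟩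
      exact ⟨⟨h1, rfl⟩, h2, h3.symm⟩
  calc (∑ i ∈ P, f (φ i)) ^ 4 = ((∑ i ∈ P, f (φ i)) ^ 2) ^ 2 := by ring
  _ ≤ (#P * ∑ i ∈ P, f (φ i) ^ 2) ^ 2 := by gcongr
  _ = (#P : ℝ) ^ 2 * (∑ x, ν x * f x ^ 2) ^ 2 := by rw [h2, mul_pow]
  _ ≤ (#P : ℝ) ^ 2 * ((∑ x, ν x ^ 2) * ∑ x, (f x ^ 2) ^ 2) := by gcongr
  _ = _ := by rw [h4, ← mul_assoc]; simp only [← pow_mul]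

namespace MulChar

variable {p : ℕ}

/-- The sum of `χ` over the integers in `(N, N + H]`. -/
noncomputable def intervalSum (χ : MulChar (ZMod p) ℂ) (N : ℤ) (H : ℕ) : ℂ :=
  ∑ n ∈ Ioc N (N + H), χ n

theorem intervalSum_add (χ : MulChar (ZMod p) ℂ) (N : ℤ) (H K : ℕ) :
    χ.intervalSum N (H + K) = χ.intervalSum N H + χ.intervalSum (N + H) K := by
  rw [intervalSum, intervalSum, intervalSum, ← sum_union (Ioc_disjoint_Ioc_of_le le_rfl),
    Ioc_union_Ioc_eq_Ioc (by omega) (by omega), Nat.cast_add, add_assoc]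

theorem intervalSum_sub_shift (χ : MulChar (ZMod p) ℂ) (N : ℤ) (H h : ℕ) :
    χ.intervalSum N H - χ.intervalSum (N + h) H =
      χ.intervalSum N h - χ.intervalSum (N + H) h := by
  have h1 := χ.intervalSum_add N H h
  have h2 := χ.intervalSum_add N h H
  rw [add_comm h H] at h2
  linear_combination h2 - h1

variable [Fact p.Prime]

theorem norm_intervalSum_le (χ : MulChar (ZMod p) ℂ) (N : ℤ) (H : ℕ) :
    ‖χ.intervalSum N H‖ ≤ H := by
  refine (norm_sum_le _ _).trans ((sum_le_card_nsmul _ _ 1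
    fun n _ ↦ norm_mulChar_apply_le_one χ _).trans_eq ?_)
  simp

theorem norm_sum_shift_intervalSum_pow_four_le {χ : MulChar (ZMod p) ℂ} (hχ : χ ^ 2 ≠ 1) (N : ℤ)
    (H : ℕ) {A B : ℕ} (hA : A < p) (hB : B ≤ p) :
    ‖∑ a ∈ Ioc 0 A, ∑ b ∈ range B, χ.intervalSum (N + (a * b : ℕ)) H‖ ^ 4 ≤
      (A * H : ℝ) ^ 2 *
        (A ^ 2 * (2 * H ^ 2 / p + 2 * A * H / p + 1) + 2 * H * (A * (1 + Real.log A))) *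
        (2 * (B : ℝ) ^ 2 * p + (2 * √p + 1) * (B : ℝ) ^ 4) := by
  have hp : p.Prime := Fact.out
  set s : Finset (ZMod p) := (range B).image (fun b : ℕ ↦ (b : ZMod p)) with hs
  have hinj : Set.InjOn (fun b : ℕ ↦ (b : ZMod p)) (range B) := by
    intro b hb c hc h
    have hb' := mem_range.1 (mem_coe.1 hb)
    have hc' := mem_range.1 (mem_coe.1 hc)
    exact Nat.ModEq.eq_of_lt_of_lt ((ZMod.natCast_eq_natCast_iff _ _ _).1 h) (hb'.trans_le hB)
      (hc'.trans_le hB)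
  have hcard : #s = B := by rw [hs, card_image_of_injOn hinj, card_range]
  have hane : ∀ a ∈ Ioc 0 A, (a : ZMod p) ≠ 0 := by
    intro a ha h
    rw [mem_Ioc] at ha
    rw [ZMod.natCast_eq_zero_iff] at h
    exact Nat.not_dvd_of_pos_of_lt ha.1 (ha.2.trans_lt hA) h
  set P : Finset (ℕ × ℤ) := Ioc 0 A ×ˢ Ioc N (N + H) with hP
  set φ : ℕ × ℤ → ZMod p := fun i ↦ (i.2 : ZMod p) / i.1 with hφ
  set f : ZMod p → ℝ := fun x ↦ ‖∑ b ∈ s, χ (x + b)‖ with hf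
  have hsum : ‖∑ a ∈ Ioc 0 A, ∑ b ∈ range B, χ.intervalSum (N + (a * b : ℕ)) H‖ ≤
      ∑ i ∈ P, f (φ i) := by
    have e : ∀ a ∈ Ioc 0 A, ∑ b ∈ range B, χ.intervalSum (N + (a * b : ℕ)) H =
        ∑ n ∈ Ioc N (N + H), χ a * ∑ b ∈ s, χ (n / a + b) := by
      intro a ha
      have h1 : ∀ b : ℕ, χ.intervalSum (N + (a * b : ℕ)) H =
          ∑ n ∈ Ioc N (N + H), χ a * χ (n / a + b) := by
        intro b
        rw [intervalSum]
        refine sum_nbij' (fun n ↦ n - (a * b : ℕ)) (fun n ↦ n + (a * b : ℕ)) ?_ ?_ ?_ ?_ ?_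
        · intro n hn
          rw [mem_Ioc] at hn ⊢
          omega
        · intro n hn
          rw [mem_Ioc] at hn ⊢
          omega
        · intro n _; ring
        · intro n _; ring
        · intro n _
          rw [← map_mul]
          congr 1
          have := hane a ha
          push_cast
          field_simp
          ring
      rw [sum_congr rfl fun b _ ↦ h1 b, sum_comm]
      refine sum_congr rfl fun n _ ↦ ?_
      rw [hs, sum_image hinj, mul_sum]
    rw [sum_congr rfl e, hP, sum_product]
    refine (norm_sum_le _ _).trans (sum_le_sum fun a ha ↦ ?_)
    refine (norm_sum_le _ _).trans (sum_le_sum fun n _ ↦ ?_)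
    rw [norm_mul]
    exact mul_le_of_le_one_left (norm_nonneg _) (norm_mulChar_apply_le_one χ _)
  have hV : (#{q ∈ P ×ˢ P | φ q.1 = φ q.2} : ℝ) ≤ ∑ a ∈ Ioc 0 A, ∑ b ∈ Ioc 0 A,
      (#{n ∈ Ioc N (N + H) ×ˢ Ioc N (N + H) | (p : ℤ) ∣ a * n.2 - b * n.1} : ℝ) := by
    rw [← sum_product']
    rw [card_eq_sum_card_fiberwise (f := fun q : (ℕ × ℤ) × ℕ × ℤ ↦ (q.1.1, q.2.1))
      (t := Ioc 0 A ×ˢ Ioc 0 A) fun q hq ↦ ?_]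
    · push_cast
      refine sum_le_sum fun t ht ↦ ?_
      rw [mem_product] at ht
      norm_cast
      refine card_le_card_of_injOn (fun q ↦ (q.1.2, q.2.2)) ?_ ?_
      · intro q hq
        simp only [coe_filter, mem_filter, mem_product, hP, Set.mem_ofPred_eq] at hq ⊢
        obtain ⟨⟨⟨⟨h1, h2⟩, h3, h4⟩, h5⟩, rfl⟩ := hq
        refine ⟨⟨h2, h4⟩, ?_⟩
        have n1 := hane _ h1
        have n2 := hane _ h3
        rw [← ZMod.intCast_zmod_eq_zero_iff_dvd]
        simp only [hφ] at h5
        rw [div_eq_div_iff n1 n2] at h5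
        push_cast
        linear_combination -h5
      · intro q hq q' hq' h
        have h1 := (mem_filter.1 (mem_coe.1 hq)).2
        have h2 := (mem_filter.1 (mem_coe.1 hq')).2
        rw [← h2] at h1
        simp only [Prod.mk.injEq] at h h1
        exact Prod.ext (Prod.ext h1.1 h.1) (Prod.ext h1.2 h.2)
    · simp only [coe_filter, mem_product, hP, Set.mem_ofPred_eq] at hq
      exact mem_coe.2 (mem_product.2 ⟨hq.1.1.1, hq.1.2.1⟩)
  have hPc : (#P : ℝ) = A * H := by
    rw [hP, card_product]
    simp
  calc _ ≤ (∑ i ∈ P, f (φ i)) ^ 4 := by gcongr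
  _ ≤ (#P : ℝ) ^ 2 * #{q ∈ P ×ˢ P | φ q.1 = φ q.2} * ∑ x, f x ^ 4 := sum_comp_pow_four_le _ _ _
  _ ≤ _ := by
    have h1 := sum_norm_sum_mulChar_pow_four_le hχ s
    rw [hcard] at h1
    have h2 := hV.trans (sum_card_pairs_dvd_le hp N H hA)
    have h3 : 0 ≤ ∑ x, f x ^ 4 := sum_nonneg fun x _ ↦ by positivity
    rw [hPc]
    gcongr

end MulChar

theorem sum_Ioc_sqrt_sq_le (A : ℕ) : (∑ a ∈ Ioc 0 A, √(a : ℝ)) ^ 2 ≤ A ^ 2 * (A + 1) / 2 := by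
  refine sq_sum_le_card_mul_sum_sq.trans_eq ?_
  simp only [Real.sq_sqrt (Nat.cast_nonneg _)]
  have : ∀ n : ℕ, ∑ a ∈ Ioc 0 n, (a : ℝ) = n * (n + 1) / 2 := fun n ↦ by
    induction n with
    | zero => simp
    | succ n ih => rw [sum_Ioc_succ_top (Nat.zero_le n), ih]; push_cast; ring
  rw [this, Nat.card_Ioc, Nat.sub_zero]
  ring

theorem sum_range_sqrt_sq_le (B : ℕ) : (∑ b ∈ range B, √(b : ℝ)) ^ 2 ≤ (B : ℝ) ^ 3 / 2 := by
  refine sq_sum_le_card_mul_sum_sq.trans ?_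
  simp only [Real.sq_sqrt (Nat.cast_nonneg _)]
  have : ∀ n : ℕ, ∑ b ∈ range n, (b : ℝ) ≤ (n : ℝ) ^ 2 / 2 := fun n ↦ by
    induction n with
    | zero => simp
    | succ n ih => rw [sum_range_succ]; push_cast; nlinarith
  rw [card_range]
  calc (B : ℝ) * _ ≤ B * (B ^ 2 / 2) := by gcongr; exact this B
  _ = _ := by ring

theorem burgess_mean_value_le {q p L l M A B H : ℝ} (hq : 316 ≤ q) (hqp : q ^ 8 = p) (hL : 46 ≤ L)
    (hM : M ^ 4 = 3.5751 ^ 4 * q ^ 6 * L) (hB : B ≤ q ^ 2) (hB' : q ^ 2 ≤ B + 1)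
    (hA : 3000 ≤ A) (hAq : A ≤ q ^ 3) (hAB : 9 * B * A ≤ H) (hH : H ≤ 9 * B * (A + 2))
    (hHq : H ≤ 2 * q ^ 5) (hl : l ≤ 3 / 8 * L) :
    (A * H) ^ 2 * (A ^ 2 * (2 * H ^ 2 / p + 2 * A * H / p + 1) + 2 * H * (A * (1 + l))) *
      (2 * B ^ 2 * p + (2 * √p + 1) * B ^ 4) ≤ (2 / 3 * (A * B) * (M * √H)) ^ 4 := by
  have hq2 : (316 : ℝ) ^ 2 ≤ q ^ 2 := by gcongr
  have hBq : 0.9999 * q ^ 2 ≤ B := by norm_num at hq2; linarith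
  have hB0 : 1 ≤ B := by norm_num at hq2; linarith
  have hH0 : 0 < H := lt_of_lt_of_le (by positivity) hAB
  have hq0 : 0 < q := by linarith
  have hp0 : 0 < p := hqp ▸ by positivity
  have hsqrt : √p = q ^ 4 := by
    rw [← hqp, show q ^ 8 = (q ^ 4) ^ 2 by ring, Real.sqrt_sq (by positivity)]
  have h1 : A * H / p ≤ 0.45 := by
    rw [div_le_iff₀ hp0, ← hqp]
    have e1 : 9 * (0.9999 * q ^ 2) * A ≤ 2 * q ^ 5 :=
      (by gcongr : 9 * (0.9999 * q ^ 2) * A ≤ 9 * B * A).trans (hAB.trans hHq)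
    have e2 : A ≤ 2 / (9 * 0.9999) * q ^ 3 := by
      have : q ^ 2 * (9 * 0.9999 * A) ≤ q ^ 2 * (2 * q ^ 3) := by linarith
      have := le_of_mul_le_mul_left this (by positivity)
      linarith
    calc A * H ≤ (2 / (9 * 0.9999) * q ^ 3) * (2 * q ^ 5) := by gcongr
    _ ≤ _ := by
      rw [show 2 / (9 * 0.9999) * q ^ 3 * (2 * q ^ 5) = 4 / (9 * 0.9999) * q ^ 8 by ring]
      gcongr
      norm_num
  have h2 : A ^ 2 / p ≤ 0.01 := by
    rw [div_le_iff₀ hp0, ← hqp]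
    calc A ^ 2 ≤ (q ^ 3) ^ 2 := by gcongr
    _ = 1 * q ^ 6 := by ring
    _ ≤ (0.01 * q ^ 2) * q ^ 6 := by gcongr; norm_num at hq2; linarith
    _ = _ := by ring
  have h3 : A / H ≤ 1 / 2 := by
    rw [div_le_iff₀ hH0]
    nlinarith
  have hV : A ^ 2 * (2 * H ^ 2 / p + 2 * A * H / p + 1) + 2 * H * (A * (1 + l)) ≤
      A * H * (0.84 * L) := by
    have e : A ^ 2 * (2 * H ^ 2 / p + 2 * A * H / p + 1) + 2 * H * (A * (1 + l)) =
        A * H * (2 * (A * H / p) + 2 * (A ^ 2 / p) + A / H + 2 + 2 * l) := by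
      field_simp
      ring
    rw [e]
    gcongr
    linarith
  have hf : 2 * B ^ 2 * p + (2 * √p + 1) * B ^ 4 ≤ 4.01 * q ^ 4 * B ^ 4 := by
    rw [hsqrt, ← hqp]
    have e1 : (0.9999 * q ^ 2) ^ 2 ≤ B ^ 2 := by gcongr
    have e2 : q ^ 4 ≤ 1.001 * B ^ 2 := by nlinarith
    have e3 : 2 * B ^ 2 * q ^ 8 ≤ 2.002 * q ^ 4 * B ^ 4 := by
      have : B ^ 2 * q ^ 4 * q ^ 4 ≤ B ^ 2 * q ^ 4 * (1.001 * B ^ 2) := by gcongr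
      linarith
    have e4 : 1 ≤ 0.001 * q ^ 4 := by nlinarith
    have e5 : (2 * q ^ 4 + 1) * B ^ 4 ≤ 2.001 * q ^ 4 * B ^ 4 := by gcongr; linarith
    have : 0 ≤ q ^ 4 * B ^ 4 := by positivity
    linarith
  have hHA : H ≤ 9.01 * A * q ^ 2 := by
    calc H ≤ 9 * B * (A + 2) := hH
    _ ≤ 9 * q ^ 2 * (A + 2) := by gcongr
    _ ≤ _ := by nlinarith [sq_nonneg q]
  calc _ ≤ (A * H) ^ 2 * (A * H * (0.84 * L)) * (4.01 * q ^ 4 * B ^ 4) := by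
        gcongr
  _ = 0.84 * 4.01 * A ^ 3 * H ^ 2 * L * q ^ 4 * B ^ 4 * H := by ring
  _ ≤ 0.84 * 4.01 * A ^ 3 * H ^ 2 * L * q ^ 4 * B ^ 4 * (9.01 * A * q ^ 2) := by gcongr
  _ = 0.84 * 4.01 * 9.01 * (A ^ 4 * H ^ 2 * L * q ^ 6 * B ^ 4) := by ring
  _ ≤ (16 / 81 * 3.5751 ^ 4) * (A ^ 4 * H ^ 2 * L * q ^ 6 * B ^ 4) :=
    mul_le_mul_of_nonneg_right (by norm_num)
      (mul_nonneg (mul_nonneg (mul_nonneg (by positivity) (by linarith)) (by positivity))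
        (by positivity))
  _ = (2 / 3) ^ 4 * (A * B) ^ 4 * (M ^ 4 * H ^ 2) := by rw [hM]; ring
  _ = (2 / 3) ^ 4 * (A * B) ^ 4 * (M ^ 4 * (√H ^ 2) ^ 2) := by rw [Real.sq_sqrt hH0.le]
  _ = _ := by ring

namespace MulChar

theorem norm_intervalSum_le_mul_sqrt {p : ℕ} [Fact p.Prime] {χ : MulChar (ZMod p) ℂ}
    (hχ : χ ^ 2 ≠ 1) {q M : ℝ} (hq : 316 ≤ q) (hqp : q ^ 8 = p) (hL : 46 ≤ Real.log p)
    (hM0 : 0 ≤ M) (hM : M ^ 4 = 3.5751 ^ 4 * q ^ 6 * Real.log p) (H : ℕ) :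
    (H : ℝ) ≤ 2 * q ^ 5 → ∀ N, ‖χ.intervalSum N H‖ ≤ M * √H := by
  induction H using Nat.strong_induction_on with
  | _ H ih =>
  intro hHq N
  rcases le_or_gt (H : ℝ) (M ^ 2) with hHM | hHM
  · refine (χ.norm_intervalSum_le N H).trans ?_
    calc (H : ℝ) = √H * √H := (Real.mul_self_sqrt (Nat.cast_nonneg H)).symm
    _ ≤ M * √H := by gcongr; exact (Real.sqrt_le_left hM0).2 hHM
  have hq0 : 0 < q := by linarith
  have hHlow : 86 * q ^ 3 ≤ H := by
    refine le_of_sq_le_sq ?_ (Nat.cast_nonneg H)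
    calc (86 * q ^ 3) ^ 2 = 86 ^ 2 * q ^ 6 := by ring
    _ ≤ 3.5751 ^ 4 * q ^ 6 * 46 := by nlinarith [pow_pos hq0 6]
    _ ≤ 3.5751 ^ 4 * q ^ 6 * Real.log p := by gcongr
    _ = (M ^ 2) ^ 2 := by rw [← hM]; ring
    _ ≤ (H : ℝ) ^ 2 := by gcongr
  have hq2 : (316 : ℝ) ^ 2 ≤ q ^ 2 := by gcongr
  norm_num at hq2
  set B := ⌊q ^ 2⌋₊ with hBdef
  have hB : (B : ℝ) ≤ q ^ 2 := Nat.floor_le (by positivity)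
  have hB' : q ^ 2 ≤ B + 1 := (Nat.lt_floor_add_one _).le
  have hB0 : (1 : ℝ) ≤ B := by linarith
  have hBpos : 0 < B := by exact_mod_cast zero_lt_one.trans_le hB0
  set K := H / (9 * B) with hK
  have hK1 : (9 * B : ℝ) * K ≤ H := by exact_mod_cast Nat.mul_div_le H (9 * B)
  have hK2 : (H : ℝ) ≤ 9 * B * (K + 1) := by
    exact_mod_cast (Nat.lt_mul_div_succ H (by omega : 0 < 9 * B)).le
  have hK3 : (3001 : ℝ) ≤ K := by
    have h1 : q ^ 2 * (86 * q) ≤ q ^ 2 * (9 * ((K : ℝ) + 1)) := by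
      calc q ^ 2 * (86 * q) = 86 * q ^ 3 := by ring
      _ ≤ 9 * B * ((K : ℝ) + 1) := hHlow.trans hK2
      _ ≤ 9 * q ^ 2 * ((K : ℝ) + 1) := by gcongr
      _ = _ := by ring
    have := le_of_mul_le_mul_left h1 (by positivity)
    linarith
  obtain ⟨A, hA⟩ : ∃ A, K = A + 1 :=
    Nat.exists_eq_add_one.2 (by exact_mod_cast (by linarith : (0 : ℝ) < K))
  rw [hA] at hK1 hK2 hK3
  push_cast at hK1 hK2 hK3
  have hAB : (9 * B : ℝ) * A ≤ H := by nlinarith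
  have hAq : (A : ℝ) ≤ q ^ 3 := by
    have : q ^ 2 * A ≤ q ^ 2 * q ^ 3 := by nlinarith
    exact le_of_mul_le_mul_left this (by positivity)
  have hA0 : (0 : ℝ) < A := by linarith
  have hq8 : q ^ 3 < q ^ 8 := pow_lt_pow_right₀ (by linarith) (by norm_num)
  have hq8' : q ^ 2 ≤ q ^ 8 := pow_le_pow_right₀ (by linarith) (by norm_num)
  have hAp : A < p := by exact_mod_cast (hAq.trans_lt hq8).trans_eq hqp
  have hBp : B ≤ p := by exact_mod_cast (hB.trans hq8').trans_eq hqp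
  have hlog : Real.log A ≤ 3 / 8 * Real.log p := by
    rw [← hqp, Real.log_pow]
    refine (Real.log_le_log hA0 hAq).trans_eq ?_
    rw [Real.log_pow]; push_cast; ring
  set T := ∑ a ∈ Ioc 0 A, ∑ b ∈ range B, χ.intervalSum (N + (a * b : ℕ)) H with hT
  have hTle : ‖T‖ ≤ 2 / 3 * (A * B) * (M * √H) := by
    refine le_of_pow_le_pow_left₀ (n := 4) (by norm_num) (by positivity) ?_
    exact (norm_sum_shift_intervalSum_pow_four_le hχ N H hAp hBp).trans
      (burgess_mean_value_le hq hqp hL hM hB hB' (by linarith) hAq hAB (by linarith) hHq hlog)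
  have hshift : ∀ a ∈ Ioc 0 A, ∀ b ∈ range B,
      ‖χ.intervalSum N H - χ.intervalSum (N + (a * b : ℕ)) H‖ ≤ 2 * M * (√a * √b) := by
    intro a ha b hb
    rw [mem_Ioc] at ha
    rw [mem_range] at hb
    have hlt : a * b < H := by
      have : (a : ℝ) * b < H := by
        have h1 : (a : ℝ) ≤ A := by exact_mod_cast ha.2
        have h2 : (b : ℝ) ≤ B := by exact_mod_cast hb.le
        calc (a : ℝ) * b ≤ A * B := by gcongr
        _ < H := by nlinarith
      exact_mod_cast this
    have hle : ((a * b : ℕ) : ℝ) ≤ 2 * q ^ 5 := le_trans (by exact_mod_cast hlt.le) hHq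
    rw [intervalSum_sub_shift]
    refine (norm_sub_le _ _).trans
      ((add_le_add (ih _ hlt hle N) (ih _ hlt hle (N + H))).trans_eq ?_)
    rw [Nat.cast_mul, Real.sqrt_mul (Nat.cast_nonneg a)]
    ring
  set X := ∑ a ∈ Ioc 0 A, √(a : ℝ) with hX
  set Y := ∑ b ∈ range B, √(b : ℝ) with hY
  have hXY : X * Y ≤ A * B * √H / 6 := by
    refine le_of_sq_le_sq ?_ (by positivity)
    calc (X * Y) ^ 2 = X ^ 2 * Y ^ 2 := by ring
    _ ≤ (A ^ 2 * (A + 1) / 2) * ((B : ℝ) ^ 3 / 2) := by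
      gcongr
      · exact sum_Ioc_sqrt_sq_le A
      · exact sum_range_sqrt_sq_le B
    _ = (A * B) ^ 2 / 36 * (9 * B * (A + 1)) := by ring
    _ ≤ (A * B) ^ 2 / 36 * H := by gcongr
    _ = (A * B) ^ 2 / 36 * √H ^ 2 := by rw [Real.sq_sqrt (Nat.cast_nonneg H)]
    _ = _ := by ring
  have herr : ‖(A * B : ℂ) * χ.intervalSum N H - T‖ ≤ 2 * M * (X * Y) := by
    have e : (A * B : ℂ) * χ.intervalSum N H - T = ∑ a ∈ Ioc 0 A, ∑ b ∈ range B,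
        (χ.intervalSum N H - χ.intervalSum (N + (a * b : ℕ)) H) := by
      simp only [sum_sub_distrib, sum_const, Nat.card_Ioc, Nat.sub_zero, card_range, hT,
        nsmul_eq_mul, mul_assoc]
    rw [e, hX, hY, sum_mul_sum, mul_sum]
    refine (norm_sum_le _ _).trans (sum_le_sum fun a ha ↦ ?_)
    rw [mul_sum]
    exact (norm_sum_le _ _).trans (sum_le_sum fun b hb ↦ hshift a ha b hb)
  have hfin : (A * B : ℝ) * ‖χ.intervalSum N H‖ ≤ (A * B : ℝ) * (M * √H) := by
    calc (A * B : ℝ) * ‖χ.intervalSum N H‖ = ‖(A * B : ℂ) * χ.intervalSum N H‖ := by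
          simp
    _ ≤ ‖(A * B : ℂ) * χ.intervalSum N H - T‖ + ‖T‖ := norm_le_norm_sub_add _ _
    _ ≤ 2 * M * (A * B * √H / 6) + 2 / 3 * (A * B) * (M * √H) := by
      gcongr
      exact herr.trans (by gcongr)
    _ = _ := by ring
  exact le_of_mul_le_mul_left hfin (by positivity)

end MulChar

section PowerResidue

variable {F : Type*} [Field F]

open Classical in
/-- The indicator function of the elements that are not `q`-th powers. -/
noncomputable def nonPowIndicator (q : ℕ) (x : F) : ℂ := if ∃ y, y ^ q = x then 0 else 1

theorem MulChar.apply_eq_one_iff_exists_pow [Finite F] {ψ : MulChar F ℂ} {x : F} (hx : x ≠ 0) :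
    ψ x = 1 ↔ ∃ y, y ^ orderOf ψ = x := by
  obtain ⟨g, hg⟩ := IsCyclic.exists_generator (α := Fˣ)
  constructor
  · intro h
    obtain ⟨k, hk⟩ := mem_powers_iff_mem_zpowers.2 (hg (Units.mk0 x hx))
    have hgk : (g : F) ^ k = x := by simpa using congrArg Units.val hk
    have hψ : ψ ^ k = 1 := by
      rw [MulChar.eq_iff hg, MulChar.pow_apply_coe, MulChar.one_apply_coe, ← map_pow, hgk, h]
    obtain ⟨m, rfl⟩ := orderOf_dvd_of_pow_eq_one hψ
    exact ⟨g ^ m, by rw [← pow_mul, mul_comm, hgk]⟩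
  · rintro ⟨y, rfl⟩
    have hy : y ≠ 0 := by
      rintro rfl
      exact hx (zero_pow (orderOf_pos ψ).ne')
    rw [map_pow, ← MulChar.pow_apply' _ (orderOf_pos ψ).ne', pow_orderOf_eq_one,
      MulChar.one_apply hy.isUnit]

theorem nonPowIndicator_orderOf_apply [Finite F] (ψ : MulChar F ℂ) {x : F} (hx : x ≠ 0) :
    nonPowIndicator (orderOf ψ) x = 1 - 1 / (orderOf ψ : ℂ) -
      1 / (orderOf ψ : ℂ) * ∑ j ∈ Ico 1 (orderOf ψ), (ψ ^ j) x := by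
  have hpos : 0 < orderOf ψ := orderOf_pos ψ
  have h0 : (orderOf ψ : ℂ) ≠ 0 := Nat.cast_ne_zero.2 hpos.ne'
  have e : 1 + ∑ j ∈ Ico 1 (orderOf ψ), (ψ ^ j) x = ∑ j ∈ range (orderOf ψ), ψ x ^ j := by
    rw [range_eq_Ico, sum_eq_sum_Ico_succ_bot hpos, pow_zero]
    congr 1
    refine sum_congr rfl fun j hj ↦ ?_
    rw [MulChar.pow_apply' _ (by have := (mem_Ico.1 hj).1; omega)]
  have h : nonPowIndicator (orderOf ψ) x =
      1 - 1 / (orderOf ψ : ℂ) * ∑ j ∈ range (orderOf ψ), ψ x ^ j := by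
    unfold nonPowIndicator
    rw [← MulChar.apply_eq_one_iff_exists_pow hx]
    split_ifs with h1
    · simp [h1, h0]
    · have : ∑ j ∈ range (orderOf ψ), ψ x ^ j = 0 := by
        have h2 := geom_sum_mul (ψ x) (orderOf ψ)
        rw [← MulChar.pow_apply' _ hpos.ne', pow_orderOf_eq_one, MulChar.one_apply hx.isUnit,
          sub_self] at h2
        exact (mul_eq_zero.1 h2).resolve_right (sub_ne_zero.2 h1)
      rw [this, mul_zero, sub_zero]
  rw [h, ← e]
  ring

theorem dvd_orderOf_mul_of_pow_eq_one {G : Type*} [CommGroup G] {l q : ℕ} (hl : l.Prime)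
    (hq : q.Prime) (hlq : l ≠ q) {x y : G} (hx : l ∣ orderOf x) (hy : y ^ q = 1) :
    l ∣ orderOf (x * y) := by
  have h : x ^ (orderOf (x * y) * q) = 1 := by
    calc x ^ (orderOf (x * y) * q) = (x * y) ^ (orderOf (x * y) * q) := by
          rw [mul_pow x y, mul_comm _ q, pow_mul y, hy, one_pow, mul_one]
    _ = 1 := by rw [pow_mul, pow_orderOf_eq_one, one_pow]
  exact (hl.dvd_mul.1 (hx.trans (orderOf_dvd_of_pow_eq_one h))).resolve_right
    fun h ↦ hlq ((Nat.prime_dvd_prime_iff_eq hl hq).1 h)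

theorem exists_mulChar_complex_orderOf [Fintype F] {n : ℕ} (h : n ∣ Fintype.card F - 1) :
    ∃ ψ : MulChar F ℂ, orderOf ψ = n := by
  have : n ≠ 0 := by
    rintro rfl
    have := Fintype.one_lt_card (α := F)
    have := Nat.eq_zero_of_zero_dvd h
    omega
  exact MulChar.exists_mulChar_orderOf F h (Complex.isPrimitiveRoot_exp n this)

/-- A bound for the sums of all characters of order divisible by `l` over a family is inherited
by their sums over the members that are not `q`-th powers for any `q ∈ s`. -/
theorem norm_sum_mulChar_mul_prod_nonPowIndicator_le [Fintype F] {ι : Type*} (I : Finset ι)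
    (f : ι → F) {l : ℕ} (hl : l.Prime) {E : ℝ}
    (hE : ∀ θ : MulChar F ℂ, l ∣ orderOf θ → ‖∑ i ∈ I, θ (f i)‖ ≤ E) (s : Finset ℕ)
    (hs : ∀ q ∈ s, q.Prime ∧ q ∣ Fintype.card F - 1 ∧ l ≠ q) (θ : MulChar F ℂ)
    (hθ : l ∣ orderOf θ) :
    ‖∑ i ∈ I, θ (f i) * ∏ q ∈ s, nonPowIndicator q (f i)‖ ≤
      (∏ q ∈ s, 2 * (1 - 1 / (q : ℝ))) * E := by
  induction s using Finset.induction_on generalizing θ with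
  | empty => simpa using hE θ hθ
  | insert q s hqs ih =>
    have ih := ih fun r hr ↦ hs r (mem_insert_of_mem hr)
    obtain ⟨hq, hqd, hlq⟩ := hs q (mem_insert_self q s)
    obtain ⟨ψ, hψ⟩ := exists_mulChar_complex_orderOf hqd
    have hq0 : (0 : ℝ) < q := by exact_mod_cast hq.pos
    have hq1 : 1 / (q : ℝ) ≤ 1 := by
      rw [div_le_one hq0]; exact_mod_cast hq.one_le
    set P : F → ℂ := fun x ↦ ∏ r ∈ s, nonPowIndicator r x with hP
    set B := (∏ r ∈ s, 2 * (1 - 1 / (r : ℝ))) * E with hB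
    have e : ∑ i ∈ I, θ (f i) * ∏ r ∈ insert q s, nonPowIndicator r (f i) =
        (1 - 1 / (q : ℝ) : ℝ) * ∑ i ∈ I, θ (f i) * P (f i) -
          (1 / (q : ℝ) : ℝ) * ∑ j ∈ Ico 1 q, ∑ i ∈ I, (θ * ψ ^ j) (f i) * P (f i) := by
      rw [sum_comm, mul_sum, mul_sum, ← sum_sub_distrib]
      refine sum_congr rfl fun i _ ↦ ?_
      rw [prod_insert hqs]
      simp only [MulChar.mul_apply, ← sum_mul, ← mul_sum]
      rcases eq_or_ne (f i) 0 with h0 | h0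
      · simp [h0, MulChar.map_zero]
      · have := nonPowIndicator_orderOf_apply ψ h0
        rw [hψ] at this
        rw [this, hP]
        push_cast
        ring
    have hsum : ‖∑ j ∈ Ico 1 q, ∑ i ∈ I, (θ * ψ ^ j) (f i) * P (f i)‖ ≤ (q - 1) * B := by
      refine (norm_sum_le_of_le _ (f := fun j ↦ ∑ i ∈ I, (θ * ψ ^ j) (f i) * P (f i))
        fun j _ ↦ ih (θ * ψ ^ j) ?_).trans_eq ?_
      · refine dvd_orderOf_mul_of_pow_eq_one hl hq hlq hθ ?_
        rw [← pow_mul, mul_comm, pow_mul, ← hψ, pow_orderOf_eq_one, one_pow]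
      · rw [sum_const, Nat.card_Ico, nsmul_eq_mul, Nat.cast_sub hq.one_le, Nat.cast_one]
    rw [e, prod_insert hqs]
    calc _ ≤ ‖((1 - 1 / (q : ℝ) : ℝ) : ℂ) * ∑ i ∈ I, θ (f i) * P (f i)‖ +
          ‖((1 / (q : ℝ) : ℝ) : ℂ) *
            ∑ j ∈ Ico 1 q, ∑ i ∈ I, (θ * ψ ^ j) (f i) * P (f i)‖ := norm_sub_le _ _
    _ ≤ (1 - 1 / (q : ℝ)) * B + 1 / (q : ℝ) * ((q - 1) * B) := by
      rw [norm_mul, norm_mul, Complex.norm_of_nonneg (sub_nonneg.2 hq1),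
        Complex.norm_of_nonneg (by positivity)]
      gcongr
      exact ih θ hθ
    _ = _ := by
      rw [hB]
      field_simp
      ring

end PowerResidue

theorem isEFree_iff {p e : ℕ} [Fact p.Prime] (he : e ≠ 0) (x : ℤ) :
    IsEFree p e x ↔
      (x : ZMod p) ≠ 0 ∧ ∀ q ∈ e.primeFactors, ¬ ∃ y : ZMod p, y ^ q = (x : ZMod p) := by
  have key (d : ℕ) : (∃ y : ℤ, x ≡ y ^ d [ZMOD p]) ↔ ∃ y : ZMod p, y ^ d = (x : ZMod p) := by
    constructor
    · rintro ⟨y, hy⟩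
      refine ⟨y, ?_⟩
      rw [← Int.cast_pow]
      exact ((ZMod.intCast_eq_intCast_iff _ _ _).2 hy).symm
    · rintro ⟨y, hy⟩
      obtain ⟨y, rfl⟩ := ZMod.intCast_surjective y
      refine ⟨y, (ZMod.intCast_eq_intCast_iff _ _ _).1 ?_⟩
      rw [Int.cast_pow, hy]
  unfold IsEFree
  rw [Ne, ZMod.intCast_zmod_eq_zero_iff_dvd]
  refine and_congr_right fun _ ↦ ⟨fun h q hq ↦ ?_, fun h d hd hd1 ↦ ?_⟩
  · rw [← key]
    exact h q (Nat.dvd_of_mem_primeFactors hq) (Nat.prime_of_mem_primeFactors hq).one_lt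
  · rw [key]
    rintro ⟨y, hy⟩
    have hm := Nat.minFac_prime hd1.ne'
    refine h d.minFac (Nat.mem_primeFactors.2 ⟨hm, (Nat.minFac_dvd d).trans hd, he⟩)
      ⟨y ^ (d / d.minFac), ?_⟩
    rw [← pow_mul, Nat.div_mul_cancel (Nat.minFac_dvd d), hy]

theorem natCast_ncountEFree {p e : ℕ} [Fact p.Prime] (he : e ≠ 0) (N H : ℤ) :
    (NcountEFree p e N H : ℂ) = ∑ n ∈ Ioc N (N + H),
      (1 : MulChar (ZMod p) ℂ) n * ∏ q ∈ e.primeFactors, nonPowIndicator q (n : ZMod p) := by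
  classical
  have e1 : {x : ℤ | N + 1 ≤ x ∧ x ≤ N + H ∧ IsEFree p e x} =
      ↑({x ∈ Ioc N (N + H) | IsEFree p e x} : Finset ℤ) := by
    ext x
    simp [and_assoc]
  rw [NcountEFree, e1, Set.ncard_coe_finset, natCast_card_filter]
  refine sum_congr rfl fun n _ ↦ ?_
  rw [isEFree_iff he]
  rcases eq_or_ne (n : ZMod p) 0 with h0 | h0
  · simp [h0, MulChar.map_zero]
  · rw [MulChar.one_apply h0.isUnit, one_mul]
    simp only [nonPowIndicator, ne_eq, h0, not_false_eq_true, true_and]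
    split_ifs with h
    · exact (prod_eq_one fun q hq ↦ if_neg (h q hq)).symm
    · push Not at h
      obtain ⟨q, hq, hy⟩ := h
      exact (prod_eq_zero (M₀ := ℂ) hq (if_pos hy)).symm

theorem abs_ncountEFree_sub_le {p e l : ℕ} [Fact p.Prime] (he : e ≠ 0) (hed : e ∣ p - 1)
    (hl : l.Prime) (hld : l ∣ p - 1) (hle : ¬ l ∣ e) (N H : ℤ) {E : ℝ}
    (hE : ∀ θ : MulChar (ZMod p) ℂ, l ∣ orderOf θ → ‖∑ n ∈ Ioc N (N + H), θ n‖ ≤ E) :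
    |(NcountEFree p (l * e) N H : ℝ) - (1 - 1 / (l : ℝ)) * (NcountEFree p e N H : ℝ)| ≤
      ((Nat.totient e : ℝ) / (e : ℝ)) * (2 : ℝ) ^ e.primeFactors.card * E := by
  have hcard : Fintype.card (ZMod p) - 1 = p - 1 := by rw [ZMod.card]
  obtain ⟨ψ, hψ⟩ := exists_mulChar_complex_orderOf (F := ZMod p) (hcard ▸ hld)
  have hle' : l ∉ e.primeFactors := fun h ↦ hle (Nat.dvd_of_mem_primeFactors h)
  have hl0 : (0 : ℝ) < l := by exact_mod_cast hl.pos
  set P : ZMod p → ℂ := fun x ↦ ∏ q ∈ e.primeFactors, nonPowIndicator q x with hP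
  set B := (∏ q ∈ e.primeFactors, 2 * (1 - 1 / (q : ℝ))) * E with hB
  have hBeq : B = ((Nat.totient e : ℝ) / (e : ℝ)) * (2 : ℝ) ^ e.primeFactors.card * E := by
    have he0 : (e : ℝ) ≠ 0 := Nat.cast_ne_zero.2 he
    have := congrArg (Rat.cast : ℚ → ℝ) (Nat.totient_eq_mul_prod_factors e)
    push_cast at this
    rw [hB, prod_mul_distrib, prod_const, this]
    simp only [one_div]
    field_simp
  rw [← hBeq, ← Real.norm_eq_abs, ← Complex.norm_real]
  have e1 : (((NcountEFree p (l * e) N H : ℝ) -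
      (1 - 1 / (l : ℝ)) * (NcountEFree p e N H : ℝ) : ℝ) : ℂ) =
      -((1 / l : ℝ) * ∑ j ∈ Ico 1 l, ∑ n ∈ Ioc N (N + H), (ψ ^ j) n * P n) := by
    push_cast
    rw [natCast_ncountEFree he, natCast_ncountEFree (mul_ne_zero hl.ne_zero he),
      Nat.primeFactors_mul hl.ne_zero he, hl.primeFactors, singleton_union, sum_comm, mul_sum,
      mul_sum, ← sum_sub_distrib, ← sum_neg_distrib]
    refine sum_congr rfl fun n _ ↦ ?_
    rw [prod_insert hle', ← sum_mul]
    rcases eq_or_ne (n : ZMod p) 0 with h0 | h0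
    · simp [h0, MulChar.map_zero]
    · have := nonPowIndicator_orderOf_apply ψ h0
      rw [hψ] at this
      rw [this, hP, MulChar.one_apply h0.isUnit]
      ring
  rw [e1, norm_neg, norm_mul, Complex.norm_of_nonneg (by positivity)]
  have hj : ∀ j ∈ Ico 1 l, ‖∑ n ∈ Ioc N (N + H), (ψ ^ j) n * P n‖ ≤ B := fun j hj ↦ by
    refine norm_sum_mulChar_mul_prod_nonPowIndicator_le _ (fun n : ℤ ↦ (n : ZMod p)) hl hE _
      (fun q hq ↦ ⟨Nat.prime_of_mem_primeFactors hq, hcard ▸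
        (Nat.dvd_of_mem_primeFactors hq).trans hed, fun h ↦ hle' (h ▸ hq)⟩) _ ?_
    rw [mem_Ico] at hj
    have hc : (orderOf ψ).Coprime j := by
      rw [hψ]
      exact Nat.coprime_of_lt_prime (by omega) hj.2 hl
    rw [hc.orderOf_pow, hψ]
  have hB0 : 0 ≤ B := (norm_nonneg _).trans (hj 1 (mem_Ico.2 ⟨le_rfl, hl.one_lt⟩))
  calc 1 / (l : ℝ) * _ ≤ 1 / (l : ℝ) * ((l - 1 : ℕ) * B) := by
        gcongr
        refine (norm_sum_le_of_le _ hj).trans_eq ?_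
        rw [sum_const, Nat.card_Ico, nsmul_eq_mul]
  _ ≤ 1 / (l : ℝ) * (l * B) := by gcongr; exact Nat.sub_le _ _
  _ = B := by field_simp

theorem le_log_of_ten_pow_twenty_le {x : ℝ} (hx : 10 ^ 20 ≤ x) : 46 ≤ Real.log x := by
  rw [Real.le_log_iff_exp_le (by linarith), show (46 : ℝ) = (46 : ℕ) * 1 by norm_num,
    Real.exp_nat_mul]
  refine le_trans ?_ hx
  calc Real.exp 1 ^ 46 ≤ 2.7182818286 ^ 46 := by
        gcongr
        exact Real.exp_one_lt_d9.le
  _ ≤ 10 ^ 20 := by norm_num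

end

theorem efree_count_comparison (p : ℕ) (hp : p.Prime) (hp20 : 10 ^ 20 ≤ p)
    (e : ℕ) (he : Even e) (hed : e ∣ p - 1)
    (l : ℕ) (hl : l.Prime) (hld : l ∣ p - 1) (hle : ¬ l ∣ e)
    (N H : ℤ) (hH1 : 1 ≤ H) (hH2 : (H : ℝ) ≤ 2 * (p : ℝ) ^ ((5 : ℝ) / 8)) :
    |(NcountEFree p (l * e) N H : ℝ) - (1 - 1 / (l : ℝ)) * (NcountEFree p e N H : ℝ)| ≤
      ((Nat.totient e : ℝ) / (e : ℝ)) * (2 : ℝ) ^ e.primeFactors.card * 3.5751 *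
        (H : ℝ) ^ ((1 : ℝ) / 2) * (p : ℝ) ^ ((3 : ℝ) / 16) * (Real.log p) ^ ((1 : ℝ) / 4) := by
  have : Fact p.Prime := ⟨hp⟩
  lift H to ℕ using (by linarith)
  rw [Int.cast_natCast] at hH2 ⊢
  have he0 : e ≠ 0 := by
    rintro rfl
    have := Nat.eq_zero_of_zero_dvd hed
    omega
  have hl2 : l ≠ 2 := fun h ↦ hle (h ▸ he.two_dvd)
  have hp20' : (10 : ℝ) ^ 20 ≤ p := by exact_mod_cast hp20
  have hp0 : (0 : ℝ) ≤ p := Nat.cast_nonneg p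
  have hL := le_log_of_ten_pow_twenty_le hp20'
  have hL0 : 0 ≤ Real.log p := by linarith
  have hpow (a : ℝ) (n : ℕ) : ((p : ℝ) ^ a) ^ n = (p : ℝ) ^ (a * n) :=
    (Real.rpow_mul_natCast hp0 a n).symm
  have hq8 : ((p : ℝ) ^ ((1 : ℝ) / 8)) ^ 8 = p := by rw [hpow]; norm_num
  have hq : 316 ≤ (p : ℝ) ^ ((1 : ℝ) / 8) := by
    refine le_of_pow_le_pow_left₀ (n := 8) (by norm_num) (by positivity) ?_
    rw [hq8]
    exact le_trans (by norm_num) hp20'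
  set M := 3.5751 * (p : ℝ) ^ ((3 : ℝ) / 16) * (Real.log p) ^ ((1 : ℝ) / 4) with hM
  have hM4 : M ^ 4 = 3.5751 ^ 4 * ((p : ℝ) ^ ((1 : ℝ) / 8)) ^ 6 * Real.log p := by
    rw [hM, mul_pow, mul_pow, hpow, hpow, ← Real.rpow_mul_natCast hL0]
    norm_num
  have hH : (H : ℝ) ≤ 2 * ((p : ℝ) ^ ((1 : ℝ) / 8)) ^ 5 := by
    rw [hpow]
    exact hH2.trans_eq (by norm_num)
  refine (abs_ncountEFree_sub_le he0 hed hl hld hle N H (E := M * √H) fun θ hθ ↦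
    MulChar.norm_intervalSum_le_mul_sqrt (fun h ↦ ?_) hq hq8 hL (by positivity) hM4 H hH
      N).trans_eq ?_
  · exact hl2 ((Nat.prime_dvd_prime_iff_eq hl Nat.prime_two).1
      (hθ.trans (orderOf_dvd_of_pow_eq_one h)))
  · rw [hM, Real.sqrt_eq_rpow]
    ring
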